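/- arXiv:2504.21479 — 7 statements merged into one kernel-verified Lean document; each statement's English description precedes it below -/
import Mathlib

section
/- Let m ≥ 0 be an integer and f : [0,∞) → ℂ be (m+1) times continuously differentiable, with M := |f(0)| + max_{0 ≤ k ≤ m} ∫₀^∞ r^k |f^{(k+1)}(r)| dr < ∞, and assume moreover that ∫₀^∞ r^{m−1/2} |f(r)| dr < ∞. Then there exists a constant C > 0 depending only on m such that for every nonzero v ∈ ℝ, | ∫₀^∞ e^{ivr} r^{m−1/2} f(r) dr | ≤ C M |v|^{−m−1/2}. -/
open MeasureTheory Set Real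

open Filter Topology

/-- The damped oscillating power weight `e^{-zr} r^s`. -/
noncomputable def expPowWeight (z : ℂ) (s r : ℝ) : ℂ :=
  Complex.exp (-(z * r)) * (r ^ s : ℝ)

lemma norm_expPowWeight (z : ℂ) (s : ℝ) {r : ℝ} (hr : 0 ≤ r) :
    ‖expPowWeight z s r‖ = r ^ s * rexp (-z.re * r) := by
  rw [expPowWeight, norm_mul, Complex.norm_exp, Complex.norm_real,
    Real.norm_of_nonneg (rpow_nonneg hr s), mul_comm]
  simp

lemma norm_expPowWeight_le {z : ℂ} (hz : 0 ≤ z.re) (s : ℝ) {r : ℝ} (hr : 0 ≤ r) :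
    ‖expPowWeight z s r‖ ≤ r ^ s := by
  rw [norm_expPowWeight z s hr]
  refine mul_le_of_le_one_right (rpow_nonneg hr s) (exp_le_one_iff.mpr ?_)
  nlinarith [mul_nonneg hz hr]

lemma measurable_expPowWeight (z : ℂ) (s : ℝ) : Measurable (expPowWeight z s) := by
  unfold expPowWeight
  fun_prop

lemma expPowWeight_eq_mul (z : ℂ) (s : ℝ) {r : ℝ} (hr : 0 < r) :
    expPowWeight z s r = r * expPowWeight z (s - 1) r := by
  have h : r ^ s = r * r ^ (s - 1) := by
    rw [rpow_sub_one hr.ne']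
    field_simp
  simp only [expPowWeight, h]
  push_cast
  ring

lemma hasDerivAt_expPowWeight (z : ℂ) (s : ℝ) {r : ℝ} (hr : 0 < r) :
    HasDerivAt (expPowWeight z s)
      (s * expPowWeight z (s - 1) r - z * expPowWeight z s r) r := by
  have h1 : HasDerivAt (fun x : ℝ => Complex.exp (-(z * x)))
      (Complex.exp (-(z * r)) * -(z * 1)) r :=
    ((Complex.ofRealCLM.hasDerivAt.const_mul z).neg).cexp
  have h2 := (Real.hasDerivAt_rpow_const (p := s) (Or.inl hr.ne')).ofReal_comp
  refine (h1.mul h2).congr_deriv ?_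
  simp only [expPowWeight]
  push_cast
  ring

lemma integrableOn_expPowWeight {z : ℂ} (hz : 0 < z.re) {s : ℝ} (hs : -1 < s) :
    IntegrableOn (expPowWeight z s) (Ioi 0) := by
  have h := integrableOn_rpow_mul_exp_neg_mul_rpow hs one_pos hz
  refine Integrable.mono' h (measurable_expPowWeight z s).aestronglyMeasurable ?_
  filter_upwards [ae_restrict_mem measurableSet_Ioi] with r hr
  rw [norm_expPowWeight z s (le_of_lt hr), rpow_one]

lemma tendsto_expPowWeight_atTop {z : ℂ} (hz : 0 < z.re) (s : ℝ) :
    Tendsto (expPowWeight z s) atTop (𝓝 0) := by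
  rw [tendsto_zero_iff_norm_tendsto_zero]
  refine (tendsto_rpow_mul_exp_neg_mul_atTop_nhds_zero s z.re hz).congr' ?_
  filter_upwards [eventually_ge_atTop 0] with r hr
  rw [norm_expPowWeight z s hr]

lemma norm_expPowWeight_le_const {z : ℂ} (hz : 0 < z.re) {s : ℝ} (hs : 0 < s) {r : ℝ}
    (hr : 0 ≤ r) : ‖expPowWeight z s r‖ ≤ (s / z.re) ^ s := by
  rw [norm_expPowWeight z s hr]
  have h1 : z.re * r / s ≤ rexp (z.re * r / s) := by
    linarith [Real.add_one_le_exp (z.re * r / s)]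
  have h2 : r ≤ s / z.re * rexp (z.re * r / s) := by
    calc r = s / z.re * (z.re * r / s) := by field_simp
      _ ≤ _ := by gcongr
  have h3 : r ^ s ≤ (s / z.re) ^ s * rexp (z.re * r) := by
    calc r ^ s ≤ (s / z.re * rexp (z.re * r / s)) ^ s := rpow_le_rpow hr h2 hs.le
      _ = (s / z.re) ^ s * rexp (z.re * r) := by
        rw [mul_rpow (by positivity) (exp_pos _).le, ← Real.exp_mul]
        congr 2
        field_simp
  calc r ^ s * rexp (-z.re * r)
      ≤ (s / z.re) ^ s * rexp (z.re * r) * rexp (-z.re * r) := by gcongr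
    _ = (s / z.re) ^ s := by rw [mul_assoc, ← Real.exp_add]; simp

/-- Integration by parts against `e^{-zr} r^s` on a half-line. -/
lemma mul_integral_expPowWeight_mul {z : ℂ} (hz : 0 < z.re) {s a B : ℝ} (ha : 0 ≤ a)
    {f f' : ℝ → ℂ} (hcont : ContinuousWithinAt (fun r => expPowWeight z s r * f r) (Ici a) a)
    (hderiv : ∀ r ∈ Ioi a, HasDerivAt f (f' r) r) (hB : ∀ r, 0 ≤ r → ‖f r‖ ≤ B)
    (h1 : IntegrableOn (fun r => expPowWeight z (s - 1) r * f r) (Ioi a))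
    (h2 : IntegrableOn (fun r => expPowWeight z s r * f r) (Ioi a))
    (h3 : IntegrableOn (fun r => expPowWeight z s r * f' r) (Ioi a)) :
    z * ∫ r in Ioi a, expPowWeight z s r * f r =
      expPowWeight z s a * f a + s * (∫ r in Ioi a, expPowWeight z (s - 1) r * f r) +
        ∫ r in Ioi a, expPowWeight z s r * f' r := by
  have hd : ∀ r ∈ Ioi a, HasDerivAt (fun r => expPowWeight z s r * f r)
      (s * (expPowWeight z (s - 1) r * f r) - z * (expPowWeight z s r * f r) +
        expPowWeight z s r * f' r) r := fun r hr =>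
    ((hasDerivAt_expPowWeight z s (ha.trans_lt hr)).mul (hderiv r hr)).congr_deriv (by ring)
  have hlim : Tendsto (fun r => expPowWeight z s r * f r) atTop (𝓝 0) := by
    have hw := (tendsto_expPowWeight_atTop hz s).norm.mul_const B
    rw [norm_zero, zero_mul] at hw
    refine squeeze_zero_norm' ?_ hw
    filter_upwards [eventually_ge_atTop 0] with r hr
    rw [norm_mul]
    exact mul_le_mul_of_nonneg_left (hB r hr) (norm_nonneg _)
  have h12 : IntegrableOn (fun r => s * (expPowWeight z (s - 1) r * f r) -
      z * (expPowWeight z s r * f r)) (Ioi a) := (h1.const_mul (s : ℂ)).sub (h2.const_mul z)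
  have h := integral_Ioi_of_hasDerivAt_of_tendsto hcont hd (h12.add h3) hlim
  rw [integral_add h12 h3,
    integral_sub (h1.const_mul (s : ℂ)) (h2.const_mul z),
    integral_const_mul, integral_const_mul] at h
  linear_combination -h

lemma norm_le_add_integral_norm_deriv {f f' : ℝ → ℂ} (hf : ContinuousOn f (Ici 0))
    (hderiv : ∀ r ∈ Ioi (0 : ℝ), HasDerivAt f (f' r) r) (hfi : IntegrableOn f' (Ioi 0))
    {r : ℝ} (hr : 0 ≤ r) : ‖f r‖ ≤ ‖f 0‖ + ∫ t in Ioi (0 : ℝ), ‖f' t‖ := by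
  have hsub : IntegrableOn f' (Ioc 0 r) := hfi.mono_set Ioc_subset_Ioi_self
  have h := intervalIntegral.integral_eq_sub_of_hasDerivAt_of_le hr
    (hf.mono Icc_subset_Ici_self) (fun x hx => hderiv x hx.1)
    ((intervalIntegrable_iff_integrableOn_Ioc_of_le hr).mpr hsub)
  have hfr : f r = f 0 + ∫ t in Ioc 0 r, f' t := by
    rw [← intervalIntegral.integral_of_le hr, h]
    ring
  rw [hfr]
  refine (norm_add_le _ _).trans (add_le_add_right ((norm_integral_le_integral_norm _).trans ?_) _)
  exact setIntegral_mono_set hfi.norm (ae_of_all _ fun _ => norm_nonneg _)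
    Ioc_subset_Ioi_self.eventuallyLE

/-- `F 1, …, F (m + 1)` are the successive derivatives of `F 0` on `[0, ∞)`, and `M` bounds
`|F 0 0|` as well as the weighted norms `∫ r ^ k |F (k + 1) r| dr` for `k ≤ m`. -/
structure WeightedDerivBound (m : ℕ) (F : ℕ → ℝ → ℂ) (M : ℝ) : Prop where
  hasDeriv : ∀ k ≤ m, ∀ r ∈ Ici (0 : ℝ), HasDerivWithinAt (F k) (F (k + 1) r) (Ici 0) r
  integrable : ∀ k ≤ m, IntegrableOn (fun r : ℝ => (r : ℂ) ^ k * F (k + 1) r) (Ioi 0)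
  integral_le : ∀ k ≤ m, ∫ r in Ioi (0 : ℝ), ‖(r : ℂ) ^ k * F (k + 1) r‖ ≤ M
  norm_zero_le : ‖F 0 0‖ ≤ M

namespace WeightedDerivBound

variable {m : ℕ} {F : ℕ → ℝ → ℂ} {M : ℝ}

lemma nonneg (h : WeightedDerivBound m F M) : 0 ≤ M := (norm_nonneg _).trans h.norm_zero_le

lemma hasDerivAt (h : WeightedDerivBound m F M) {r : ℝ} (hr : 0 < r) :
    HasDerivAt (F 0) (F 1 r) r :=
  (h.hasDeriv 0 m.zero_le r hr.le).hasDerivAt (Ici_mem_nhds hr)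

lemma continuousOn (h : WeightedDerivBound m F M) : ContinuousOn (F 0) (Ici 0) :=
  fun r hr => (h.hasDeriv 0 m.zero_le r hr).continuousWithinAt

lemma aestronglyMeasurable (h : WeightedDerivBound m F M) {a : ℝ} (ha : 0 ≤ a) :
    AEStronglyMeasurable (F 0) (volume.restrict (Ioi a)) :=
  (h.continuousOn.mono fun _ hr => ha.trans (le_of_lt hr)).aestronglyMeasurable measurableSet_Ioi

lemma integrableOn_one (h : WeightedDerivBound m F M) : IntegrableOn (F 1) (Ioi 0) := by
  simpa using h.integrable 0 m.zero_le

lemma integral_norm_one_le (h : WeightedDerivBound m F M) :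
    ∫ r in Ioi (0 : ℝ), ‖F 1 r‖ ≤ M := by
  simpa using h.integral_le 0 m.zero_le

lemma norm_le (h : WeightedDerivBound m F M) {r : ℝ} (hr : 0 ≤ r) : ‖F 0 r‖ ≤ 2 * M := by
  have := norm_le_add_integral_norm_deriv h.continuousOn (fun r hr => h.hasDerivAt hr)
    h.integrableOn_one hr
  linarith [h.integral_norm_one_le, h.norm_zero_le]

lemma ae_norm_le (h : WeightedDerivBound m F M) {a : ℝ} (ha : 0 ≤ a) :
    ∀ᵐ r ∂volume.restrict (Ioi a), ‖F 0 r‖ ≤ 2 * M := by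
  filter_upwards [ae_restrict_mem measurableSet_Ioi] with r hr
  exact h.norm_le (ha.trans (le_of_lt hr))

lemma integrableOn_mul (h : WeightedDerivBound m F M) {z : ℂ} (hz : 0 < z.re) {s a : ℝ}
    (hs : -1 < s) (ha : 0 ≤ a) : IntegrableOn (fun r => expPowWeight z s r * F 0 r) (Ioi a) :=
  ((integrableOn_expPowWeight hz hs).mono_set (Ioi_subset_Ioi ha)).mul_bdd
    (h.aestronglyMeasurable ha) (h.ae_norm_le ha)

/-- The sequence of derivatives of `(m + 1/2) F 0 + r F 1`. -/
lemma euler (h : WeightedDerivBound (m + 1) F M) :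
    WeightedDerivBound m (fun k r => ((m : ℂ) + 1 / 2 + k) * F k r + r * F (k + 1) r)
      ((2 * m + 3) * M) where
  hasDeriv k hk r hr := by
    have h1 := h.hasDeriv k (by omega) r hr
    have h2 := h.hasDeriv (k + 1) (by omega) r hr
    have h3 : HasDerivWithinAt (fun r : ℝ => (r : ℂ)) 1 (Ici 0) r :=
      Complex.ofRealCLM.hasDerivAt.hasDerivWithinAt
    refine ((h1.const_mul ((m : ℂ) + 1 / 2 + k)).add (h3.mul h2)).congr_deriv ?_
    push_cast
    ring
  integrable k hk := by
    refine IntegrableOn.congr_fun (((h.integrable k (by omega)).const_mul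
      ((m : ℂ) + 1 / 2 + (k + 1 : ℕ))).add (h.integrable (k + 1) (by omega)))
      (fun r _ => ?_) measurableSet_Ioi
    simp only [Pi.add_apply]
    ring
  integral_le k hk := by
    have i1 := ((h.integrable k (by omega)).norm).const_mul ((m : ℝ) + 1 / 2 + (k + 1 : ℕ))
    have i2 := (h.integrable (k + 1) (by omega)).norm
    have hle : ∫ r in Ioi (0 : ℝ), ‖(r : ℂ) ^ k * (((m : ℂ) + 1 / 2 + (k + 1 : ℕ)) * F (k + 1) r +
          r * F (k + 1 + 1) r)‖ ≤
        ∫ r in Ioi (0 : ℝ), (((m : ℝ) + 1 / 2 + (k + 1 : ℕ)) * ‖(r : ℂ) ^ k * F (k + 1) r‖ +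
          ‖(r : ℂ) ^ (k + 1) * F (k + 1 + 1) r‖) := by
      refine integral_mono_of_nonneg (ae_of_all _ fun _ => norm_nonneg _) (i1.add i2)
        (ae_of_all _ fun r => ?_)
      have hn : ‖(m : ℂ) + 1 / 2 + (k + 1 : ℕ)‖ = (m : ℝ) + 1 / 2 + (k + 1 : ℕ) := by
        rw [← Complex.norm_of_nonneg (by positivity : 0 ≤ (m : ℝ) + 1 / 2 + (k + 1 : ℕ))]
        push_cast
        rfl
      calc _ = ‖((m : ℂ) + 1 / 2 + (k + 1 : ℕ)) * ((r : ℂ) ^ k * F (k + 1) r) +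
            (r : ℂ) ^ (k + 1) * F (k + 1 + 1) r‖ := by ring_nf
        _ ≤ _ := (norm_add_le _ _).trans_eq (by rw [norm_mul, hn])
    rw [integral_add i1 i2, integral_const_mul] at hle
    have hk' : (k : ℝ) ≤ m := by exact_mod_cast hk
    have h1 := h.integral_le k (by omega)
    have h2 := h.integral_le (k + 1) (by omega)
    have h3 := mul_le_mul_of_nonneg_left h1
      (by positivity : 0 ≤ (m : ℝ) + 1 / 2 + (k + 1 : ℕ))
    refine hle.trans ((add_le_add h3 h2).trans ?_)
    push_cast
    nlinarith [h.nonneg]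
  norm_zero_le := by
    have hn : ‖(m : ℂ) + 1 / 2‖ = (m : ℝ) + 1 / 2 := by
      rw [← Complex.norm_of_nonneg (by positivity : 0 ≤ (m : ℝ) + 1 / 2)]
      push_cast
      rfl
    have hM := h.nonneg
    simp only [Nat.cast_zero, add_zero, Complex.ofReal_zero, zero_mul, norm_mul, hn]
    have := mul_le_mul_of_nonneg_left h.norm_zero_le (by positivity : 0 ≤ (m : ℝ) + 1 / 2)
    nlinarith [mul_nonneg (Nat.cast_nonneg (α := ℝ) m) hM]

lemma mul_integral_succ (h : WeightedDerivBound (m + 1) F M) {z : ℂ} (hz : 0 < z.re) :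
    z * ∫ r in Ioi (0 : ℝ), expPowWeight z ((m + 1 : ℕ) - 1 / 2) r * F 0 r =
      ∫ r in Ioi (0 : ℝ), expPowWeight z (m - 1 / 2) r *
        (((m : ℂ) + 1 / 2 + (0 : ℕ)) * F 0 r + r * F (0 + 1) r) := by
  have hm : (0 : ℝ) ≤ m := m.cast_nonneg
  have hs : ((m + 1 : ℕ) : ℝ) - 1 / 2 = m + 1 / 2 := by push_cast; ring
  have hs1 : (m : ℝ) + 1 / 2 - 1 = m - 1 / 2 := by ring
  rw [hs]
  have hpos : (0 : ℝ) < m + 1 / 2 := by positivity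
  have h1 := h.integrableOn_mul hz (s := (m : ℝ) + 1 / 2 - 1) (by linarith) le_rfl
  have h2 := h.integrableOn_mul hz (s := (m : ℝ) + 1 / 2) (by linarith) le_rfl
  have h3 : IntegrableOn (fun r => expPowWeight z ((m : ℝ) + 1 / 2) r * F 1 r) (Ioi 0) := by
    refine Integrable.bdd_mul h.integrableOn_one
      (measurable_expPowWeight z _).aestronglyMeasurable
      (c := ((m + 1 / 2 : ℝ) / z.re) ^ (m + 1 / 2 : ℝ)) ?_
    filter_upwards [ae_restrict_mem measurableSet_Ioi] with r hr
    exact norm_expPowWeight_le_const hz hpos (le_of_lt hr)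
  have hcont : ContinuousWithinAt (fun r => expPowWeight z ((m : ℝ) + 1 / 2) r * F 0 r)
      (Ici 0) 0 := by
    refine ContinuousWithinAt.mul (Continuous.continuousWithinAt ?_)
      (h.continuousOn 0 self_mem_Ici)
    unfold expPowWeight
    have := Real.continuous_rpow_const hpos.le
    fun_prop
  rw [mul_integral_expPowWeight_mul hz le_rfl hcont (fun r hr => h.hasDerivAt hr)
    (fun r hr => h.norm_le hr) h1 h2 h3]
  have h0 : expPowWeight z ((m : ℝ) + 1 / 2) 0 = 0 := by
    rw [expPowWeight, Real.zero_rpow hpos.ne', Complex.ofReal_zero, mul_zero]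
  rw [h0, zero_mul, zero_add, ← integral_const_mul, ← integral_add (h1.const_mul _) h3]
  refine setIntegral_congr_fun measurableSet_Ioi fun r hr => ?_
  simp only [expPowWeight_eq_mul z ((m : ℝ) + 1 / 2) hr, hs1]
  push_cast
  ring

lemma norm_integral_Ioc_le (h : WeightedDerivBound m F M) {z : ℂ} (hz : 0 < z.re) {a : ℝ}
    (ha : 0 < a) :
    ‖∫ r in Ioc 0 a, expPowWeight z (-1 / 2) r * F 0 r‖ ≤ 4 * M * a ^ (1 / 2 : ℝ) := by
  have hfi : IntervalIntegrable (fun r : ℝ => r ^ (-1 / 2 : ℝ)) volume 0 a :=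
    intervalIntegral.intervalIntegrable_rpow' (by norm_num)
  have hval : ∫ r in Ioc 0 a, r ^ (-1 / 2 : ℝ) = 2 * a ^ (1 / 2 : ℝ) := by
    rw [← intervalIntegral.integral_of_le ha.le, integral_rpow (Or.inl (by norm_num))]
    norm_num
    ring
  have hle : ‖∫ r in Ioc 0 a, expPowWeight z (-1 / 2) r * F 0 r‖ ≤
      ∫ r in Ioc 0 a, r ^ (-1 / 2 : ℝ) * (2 * M) := by
    refine norm_integral_le_of_norm_le
      (((intervalIntegrable_iff_integrableOn_Ioc_of_le ha.le).mp hfi).mul_const _) ?_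
    filter_upwards [ae_restrict_mem measurableSet_Ioc] with r hr
    rw [norm_mul]
    exact mul_le_mul (norm_expPowWeight_le hz.le _ hr.1.le) (h.norm_le hr.1.le) (norm_nonneg _)
      (rpow_nonneg hr.1.le _)
  rw [integral_mul_const, hval] at hle
  linarith

lemma norm_mul_norm_integral_Ioi_le (h : WeightedDerivBound m F M) {z : ℂ} (hz : 0 < z.re)
    {a : ℝ} (ha : 0 < a) :
    ‖z‖ * ‖∫ r in Ioi a, expPowWeight z (-1 / 2) r * F 0 r‖ ≤ 5 * M * a ^ (-1 / 2 : ℝ) := by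
  have hpow : IntegrableOn (fun r : ℝ => r ^ (-1 / 2 - 1 : ℝ) * (2 * M)) (Ioi a) :=
    (integrableOn_Ioi_rpow_of_lt (by norm_num) ha).mul_const _
  have hb1 : ∀ᵐ r ∂volume.restrict (Ioi a),
      ‖expPowWeight z (-1 / 2 - 1) r * F 0 r‖ ≤ r ^ (-1 / 2 - 1 : ℝ) * (2 * M) := by
    filter_upwards [ae_restrict_mem measurableSet_Ioi] with r hr
    have hr0 : 0 ≤ r := ha.le.trans (le_of_lt hr)
    rw [norm_mul]
    exact mul_le_mul (norm_expPowWeight_le hz.le _ hr0) (h.norm_le hr0) (norm_nonneg _)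
      (rpow_nonneg hr0 _)
  have hF1 : IntegrableOn (F 1) (Ioi a) := h.integrableOn_one.mono_set (Ioi_subset_Ioi ha.le)
  have hbw : ∀ r ∈ Ici a, ‖expPowWeight z (-1 / 2) r‖ ≤ a ^ (-1 / 2 : ℝ) := fun r hr =>
    (norm_expPowWeight_le hz.le _ (ha.le.trans hr)).trans
      (rpow_le_rpow_of_nonpos ha hr (by norm_num))
  have hbw' : ∀ᵐ r ∂volume.restrict (Ioi a),
      ‖expPowWeight z (-1 / 2) r‖ ≤ a ^ (-1 / 2 : ℝ) := by
    filter_upwards [ae_restrict_mem measurableSet_Ioi] with r hr using hbw r (Ioi_subset_Ici_self hr)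
  have h1 : IntegrableOn (fun r => expPowWeight z (-1 / 2 - 1) r * F 0 r) (Ioi a) :=
    Integrable.mono' hpow ((measurable_expPowWeight z _).aestronglyMeasurable.mul
      (h.aestronglyMeasurable ha.le)) hb1
  have h2 := h.integrableOn_mul hz (s := -1 / 2) (by norm_num) ha.le
  have h3 : IntegrableOn (fun r => expPowWeight z (-1 / 2) r * F 1 r) (Ioi a) :=
    Integrable.bdd_mul hF1 (measurable_expPowWeight z _).aestronglyMeasurable hbw'
  have hcont : ContinuousWithinAt (fun r => expPowWeight z (-1 / 2) r * F 0 r) (Ici a) a :=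
    ((hasDerivAt_expPowWeight z _ ha).continuousAt.mul
      (h.hasDerivAt ha).continuousAt).continuousWithinAt
  rw [← norm_mul, mul_integral_expPowWeight_mul hz ha.le hcont
    (fun r hr => h.hasDerivAt (ha.trans hr)) (fun r hr => h.norm_le hr) h1 h2 h3]
  have e1 : ‖expPowWeight z (-1 / 2) a * F 0 a‖ ≤ a ^ (-1 / 2 : ℝ) * (2 * M) := by
    rw [norm_mul]
    exact mul_le_mul (hbw a self_mem_Ici) (h.norm_le ha.le) (norm_nonneg _)
      (rpow_nonneg ha.le _)
  have e2 : ‖((-1 / 2 : ℝ) : ℂ) * ∫ r in Ioi a, expPowWeight z (-1 / 2 - 1) r * F 0 r‖ ≤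
      a ^ (-1 / 2 : ℝ) * (2 * M) := by
    have := norm_integral_le_of_norm_le hpow hb1
    rw [integral_mul_const, integral_Ioi_rpow_of_lt (by norm_num) ha] at this
    rw [norm_mul, Complex.norm_real]
    norm_num at this ⊢
    linarith
  have e3 : ‖∫ r in Ioi a, expPowWeight z (-1 / 2) r * F 1 r‖ ≤ a ^ (-1 / 2 : ℝ) * M := by
    have hle : ‖∫ r in Ioi a, expPowWeight z (-1 / 2) r * F 1 r‖ ≤
        ∫ r in Ioi a, a ^ (-1 / 2 : ℝ) * ‖F 1 r‖ := by
      refine norm_integral_le_of_norm_le (hF1.norm.const_mul _) ?_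
      filter_upwards [hbw'] with r hr
      rw [norm_mul]
      exact mul_le_mul_of_nonneg_right hr (norm_nonneg _)
    rw [integral_const_mul] at hle
    refine hle.trans (mul_le_mul_of_nonneg_left (le_trans ?_ h.integral_norm_one_le)
      (rpow_nonneg ha.le _))
    exact setIntegral_mono_set h.integrableOn_one.norm (ae_of_all _ fun _ => norm_nonneg _)
      (Ioi_subset_Ioi ha.le).eventuallyLE
  linarith [norm_add₃_le (a := expPowWeight z (-1 / 2) a * F 0 a)
    (b := ((-1 / 2 : ℝ) : ℂ) * ∫ r in Ioi a, expPowWeight z (-1 / 2 - 1) r * F 0 r)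
    (c := ∫ r in Ioi a, expPowWeight z (-1 / 2) r * F 1 r)]

lemma norm_integral_neg_half_le (h : WeightedDerivBound m F M) {z : ℂ} (hz : 0 < z.re) :
    ‖∫ r in Ioi (0 : ℝ), expPowWeight z (-1 / 2) r * F 0 r‖ ≤ 9 * M * ‖z‖ ^ (-1 / 2 : ℝ) := by
  have hz0 : 0 < ‖z‖ := norm_pos_iff.mpr fun h0 => by simp [h0] at hz
  have ha : 0 < ‖z‖⁻¹ := inv_pos.mpr hz0
  have hfi := h.integrableOn_mul hz (s := -1 / 2) (by norm_num) le_rfl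
  rw [← Ioc_union_Ioi_eq_Ioi ha.le, setIntegral_union Ioc_disjoint_Ioi_same
    measurableSet_Ioi (hfi.mono_set Ioc_subset_Ioi_self) (hfi.mono_set (Ioi_subset_Ioi ha.le))]
  have e1 := h.norm_integral_Ioc_le hz ha
  have e2 := h.norm_mul_norm_integral_Ioi_le hz ha
  have p1 : (‖z‖⁻¹) ^ (1 / 2 : ℝ) = ‖z‖ ^ (-1 / 2 : ℝ) := by
    rw [inv_rpow hz0.le, ← rpow_neg hz0.le]
    norm_num
  have p2 : (‖z‖⁻¹) ^ (-1 / 2 : ℝ) = ‖z‖ * ‖z‖ ^ (-1 / 2 : ℝ) := by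
    rw [inv_rpow hz0.le, ← rpow_neg hz0.le, ← rpow_one_add' hz0.le (by norm_num)]
    norm_num
  rw [p1] at e1
  rw [p2, mul_left_comm] at e2
  have e3 := le_of_mul_le_mul_left e2 hz0
  linarith [norm_add_le (∫ r in Ioc 0 ‖z‖⁻¹, expPowWeight z (-1 / 2) r * F 0 r)
    (∫ r in Ioi ‖z‖⁻¹, expPowWeight z (-1 / 2) r * F 0 r)]

end WeightedDerivBound

lemma exists_norm_integral_expPowWeight_le (m : ℕ) :
    ∃ C : ℝ, 0 < C ∧ ∀ (F : ℕ → ℝ → ℂ) (M : ℝ), WeightedDerivBound m F M →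
      ∀ z : ℂ, 0 < z.re → ‖∫ r in Ioi (0 : ℝ), expPowWeight z (m - 1 / 2) r * F 0 r‖ ≤
        C * M * ‖z‖ ^ (-(m : ℝ) - 1 / 2) := by
  induction m with
  | zero =>
    refine ⟨9, by norm_num, fun F M h z hz => ?_⟩
    have := h.norm_integral_neg_half_le hz
    norm_num at this ⊢
    exact this
  | succ m ih =>
    obtain ⟨C, hC, hbound⟩ := ih
    refine ⟨C * (2 * m + 3), by positivity, fun F M h z hz => ?_⟩
    have hz0 : 0 < ‖z‖ := norm_pos_iff.mpr fun h0 => by simp [h0] at hz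
    have hG := hbound _ _ h.euler z hz
    rw [← h.mul_integral_succ hz, norm_mul] at hG
    refine le_of_mul_le_mul_left (hG.trans_eq ?_) hz0
    have hp : ‖z‖ ^ (-(m : ℝ) - 1 / 2) = ‖z‖ * ‖z‖ ^ (-((m + 1 : ℕ) : ℝ) - 1 / 2) := by
      rw [← rpow_one_add' hz0.le]
      · push_cast
        congr 1
        ring
      · push_cast
        have : (0 : ℝ) ≤ m := m.cast_nonneg
        linarith
    rw [hp]
    ring

lemma weightedDerivBound_iteratedDerivWithin {m : ℕ} {f : ℝ → ℂ} {M : ℝ}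
    (hf : ContDiffOn ℝ (m + 1) f (Ici 0))
    (hfi : ∀ k ≤ m, IntegrableOn (fun r : ℝ => r ^ k *
      ‖iteratedDerivWithin (k + 1) f (Ici 0) r‖) (Ioi 0))
    (hM : ∀ k ≤ m, ∫ r in Ioi (0 : ℝ), r ^ k *
      ‖iteratedDerivWithin (k + 1) f (Ici 0) r‖ ≤ M) (h0 : ‖f 0‖ ≤ M) :
    WeightedDerivBound m (fun k => iteratedDerivWithin k f (Ici 0)) M where
  hasDeriv k hk r hr := by
    have hd := hf.differentiableOn_iteratedDerivWithin (m := k)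
      (by exact_mod_cast Nat.lt_succ_of_le hk) (uniqueDiffOn_Ici 0) r hr
    simpa only [iteratedDerivWithin_succ] using hd.hasDerivWithinAt
  integrable k hk := by
    refine Integrable.mono' (hfi k hk) ?_ ?_
    · have hc := hf.continuousOn_iteratedDerivWithin (m := k + 1)
        (by exact_mod_cast Nat.succ_le_succ hk) (uniqueDiffOn_Ici 0)
      have hc' : ContinuousOn (fun r : ℝ => (r : ℂ) ^ k) (Ici 0) := by fun_prop
      exact ((hc'.mul hc).mono Ioi_subset_Ici_self).aestronglyMeasurable measurableSet_Ioi
    · filter_upwards [ae_restrict_mem measurableSet_Ioi] with r hr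
      rw [norm_mul, norm_pow, Complex.norm_of_nonneg (le_of_lt hr)]
  integral_le k hk := by
    refine le_of_eq_of_le (setIntegral_congr_fun measurableSet_Ioi fun r hr => ?_) (hM k hk)
    simp only [norm_mul, norm_pow, Complex.norm_of_nonneg (le_of_lt hr)]
  norm_zero_le := by simpa using h0

lemma tendsto_integral_expPowWeight_mul {f : ℝ → ℂ} {s : ℝ}
    (hf : AEStronglyMeasurable f (volume.restrict (Ioi 0)))
    (hfi : IntegrableOn (fun r : ℝ => r ^ s * ‖f r‖) (Ioi 0)) (v : ℝ) :
    Tendsto (fun ε : ℝ => ∫ r in Ioi (0 : ℝ), expPowWeight (ε - Complex.I * v) s r * f r)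
      (𝓝[>] 0) (𝓝 (∫ r in Ioi (0 : ℝ), Complex.exp (Complex.I * (v * r)) *
        (r ^ s : ℝ) * f r)) := by
  refine tendsto_integral_filter_of_dominated_convergence _
    (Eventually.of_forall fun ε => (measurable_expPowWeight _ s).aestronglyMeasurable.mul hf)
    ?_ hfi (ae_of_all _ fun r => ?_)
  · filter_upwards [self_mem_nhdsWithin] with ε hε
    filter_upwards [ae_restrict_mem measurableSet_Ioi] with r hr
    rw [norm_mul]
    refine mul_le_mul_of_nonneg_right (norm_expPowWeight_le ?_ s (le_of_lt hr)) (norm_nonneg _)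
    simpa using le_of_lt hε
  · have hc : Continuous fun ε : ℝ => expPowWeight (ε - Complex.I * v) s r * f r := by
      unfold expPowWeight
      fun_prop
    have ht := (hc.tendsto 0).mono_left (nhdsWithin_le_nhds (s := Ioi 0))
    convert ht using 2
    simp only [expPowWeight, Complex.ofReal_zero]
    ring_nf

/-- oscillatory integral bound with a half-integer power weight. -/
theorem stmt4 (m : ℕ) :
    ∃ C : ℝ, 0 < C ∧
      ∀ f : ℝ → ℂ, ContDiffOn ℝ (m + 1) f (Ici 0) →
        (∀ k : ℕ, k ≤ m →
          IntegrableOn (fun r : ℝ => r ^ k *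
            ‖iteratedDerivWithin (k + 1) f (Ici 0) r‖) (Ioi 0)) →
        IntegrableOn (fun r : ℝ => r ^ ((m : ℝ) - 1 / 2) * ‖f r‖) (Ioi 0) →
        ∀ v : ℝ, v ≠ 0 →
          ‖∫ r in Ioi (0 : ℝ), Complex.exp (Complex.I * (v * r)) *
              (r ^ ((m : ℝ) - 1 / 2) : ℝ) * f r‖
            ≤ C * (‖f 0‖ + (Finset.range (m + 1)).sup'
                (Finset.nonempty_range_iff.mpr (Nat.succ_ne_zero m))
                (fun k => ∫ r in Ioi (0 : ℝ), r ^ k *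
                  ‖iteratedDerivWithin (k + 1) f (Ici 0) r‖))
              * |v| ^ (-(m : ℝ) - 1 / 2) := by
  obtain ⟨C, hC, hbound⟩ := exists_norm_integral_expPowWeight_le m
  refine ⟨C, hC, fun f hf hfi hfi0 v hv => ?_⟩
  set g : ℕ → ℝ := fun k => ∫ r in Ioi (0 : ℝ), r ^ k *
    ‖iteratedDerivWithin (k + 1) f (Ici 0) r‖ with hg
  set S := (Finset.range (m + 1)).sup'
    (Finset.nonempty_range_iff.mpr (Nat.succ_ne_zero m)) g with hS
  have hle : ∀ k ≤ m, g k ≤ S := fun k hk =>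
    Finset.le_sup' g (Finset.mem_range.mpr (Nat.lt_succ_of_le hk))
  have hS0 : 0 ≤ S := (setIntegral_nonneg measurableSet_Ioi fun r hr =>
    mul_nonneg (pow_nonneg (le_of_lt hr) 0) (norm_nonneg _)).trans (hle 0 m.zero_le)
  have hF : WeightedDerivBound m (fun k => iteratedDerivWithin k f (Ici 0)) (‖f 0‖ + S) :=
    weightedDerivBound_iteratedDerivWithin hf hfi
      (fun k hk => (hle k hk).trans (le_add_of_nonneg_left (norm_nonneg _)))
      (le_add_of_nonneg_right hS0)
  have hlim := (tendsto_integral_expPowWeight_mul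
    ((hf.continuousOn.mono Ioi_subset_Ici_self).aestronglyMeasurable measurableSet_Ioi)
    hfi0 v).norm
  refine le_of_tendsto hlim ?_
  filter_upwards [self_mem_nhdsWithin] with ε hε
  have hre : ((ε : ℂ) - Complex.I * v).re = ε := by simp
  have him : ((ε : ℂ) - Complex.I * v).im = -v := by simp
  have hb := hbound _ _ hF (ε - Complex.I * v) (hre.symm ▸ hε)
  simp only [iteratedDerivWithin_zero] at hb
  refine hb.trans (mul_le_mul_of_nonneg_left ?_ (mul_nonneg hC.le hF.nonneg))
  refine rpow_le_rpow_of_nonpos (abs_pos.mpr hv) ?_ ?_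
  · simpa only [him, abs_neg] using Complex.abs_im_le_norm ((ε : ℂ) - Complex.I * v)
  · have : (0 : ℝ) ≤ m := m.cast_nonneg
    linarith
end

section
/- Let g : [0,∞) → ℂ be continuously differentiable with ∫₀^∞ |g'(r)| dr < ∞ and ∫₀^∞ |g(u²)| du < ∞. Then there exists an absolute constant C > 0 such that for every v > 0, | ∫₀^∞ e^{i v u²} g(u²) du | ≤ C v^{−1/2} ( |g(0)| + ∫₀^∞ |g'(r)| dr ). -/
open MeasureTheory Set Real

theorem norm_exp_I_mul_sq (v t : ℝ) : ‖Complex.exp (Complex.I * (v * t ^ 2))‖ = 1 := by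
  rw [mul_comm]
  exact_mod_cast Complex.norm_exp_ofReal_mul_I (v * t ^ (2 : ℕ))

theorem continuous_exp_I_mul_sq (v : ℝ) :
    Continuous fun t : ℝ => Complex.exp (Complex.I * (v * t ^ 2)) := by
  fun_prop

theorem norm_integral_exp_I_mul_sq_le_of_pos {v a b : ℝ} (hv : 0 < v) (ha : 0 < a) (hab : a ≤ b) :
    ‖∫ t in a..b, Complex.exp (Complex.I * (v * t ^ 2))‖ ≤ 1 / (v * a) := by
  have hb : 0 < b := ha.trans_le hab
  have hpos : ∀ t ∈ uIcc a b, 0 < t := fun t ht => ha.trans_le (uIcc_of_le hab ▸ ht).1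
  have hvC : (v : ℂ) ≠ 0 := by exact_mod_cast hv.ne'
  set e : ℝ → ℂ := fun t => Complex.exp (Complex.I * (v * t ^ 2)) with he
  have hcont : Continuous e := continuous_exp_I_mul_sq v
  have hne : ∀ t : ℝ, ‖e t‖ = 1 := norm_exp_I_mul_sq v
  let F : ℝ → ℂ := fun t => e t / (2 * Complex.I * v * t)
  let G : ℝ → ℂ := fun t => e t / (2 * Complex.I * v * t ^ 2)
  have hF : ∀ t ∈ uIcc a b, HasDerivAt F (e t - G t) t := by
    intro t ht
    have htC : (t : ℂ) ≠ 0 := by exact_mod_cast (hpos t ht).ne'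
    have h1 : HasDerivAt (fun z : ℂ => Complex.exp (Complex.I * (v * z ^ 2)) /
        (2 * Complex.I * v * z)) (e t - G t) (t : ℂ) := by
      have h2 := (((((hasDerivAt_id (t : ℂ)).pow 2).const_mul (v : ℂ)).const_mul
        Complex.I).cexp).div ((hasDerivAt_id (t : ℂ)).const_mul (2 * Complex.I * v))
        (by simp [hvC, htC])
      refine h2.congr_deriv ?_
      simp only [G, he, id, Pi.pow_apply]
      field_simp
      ring
    exact h1.comp_ofReal
  have hGint : IntervalIntegrable G volume a b := by
    refine ContinuousOn.intervalIntegrable (hcont.continuousOn.div (by fun_prop) ?_)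
    intro t ht
    have htC : (t : ℂ) ≠ 0 := by exact_mod_cast (hpos t ht).ne'
    simp [hvC, htC]
  have heint : IntervalIntegrable e volume a b := hcont.intervalIntegrable a b
  have hFTC := intervalIntegral.integral_eq_sub_of_hasDerivAt hF (heint.sub hGint)
  rw [intervalIntegral.integral_sub heint hGint] at hFTC
  have hnF : ∀ t : ℝ, 0 < t → ‖F t‖ = 1 / (2 * v * t) := by
    intro t ht
    simp [F, hne, abs_of_pos hv, abs_of_pos ht]
  have hG : ‖∫ t in a..b, G t‖ ≤ 1 / (2 * v * a) - 1 / (2 * v * b) := by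
    have hi : IntervalIntegrable (fun t : ℝ => 1 / (2 * v * t ^ 2)) volume a b := by
      refine ContinuousOn.intervalIntegrable (continuousOn_const.div (by fun_prop) ?_)
      intro t ht
      have := hpos t ht
      positivity
    have hd : ∀ t ∈ uIcc a b, HasDerivAt (fun t : ℝ => -(1 / (2 * v * t)))
        (1 / (2 * v * t ^ 2)) t := by
      intro t ht
      have ht0 := (hpos t ht).ne'
      have h2 := ((hasDerivAt_const t (1 : ℝ)).div ((hasDerivAt_id t).const_mul (2 * v))
        (by simp [hv.ne', ht0])).neg
      refine h2.congr_deriv ?_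
      simp only [id]
      field_simp
      ring
    calc ‖∫ t in a..b, G t‖ ≤ ∫ t in a..b, 1 / (2 * v * t ^ 2) := by
          refine intervalIntegral.norm_integral_le_of_norm_le hab (.of_forall fun t _ => ?_) hi
          simp [G, hne, abs_of_pos hv]
      _ = 1 / (2 * v * a) - 1 / (2 * v * b) := by
          rw [intervalIntegral.integral_eq_sub_of_hasDerivAt hd hi]
          ring
  calc ‖∫ t in a..b, e t‖ = ‖F b - F a + ∫ t in a..b, G t‖ := by rw [← hFTC]; simp
    _ ≤ ‖F b‖ + ‖F a‖ + ‖∫ t in a..b, G t‖ :=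
        (norm_add_le _ _).trans (by gcongr; exact norm_sub_le _ _)
    _ ≤ 1 / (2 * v * b) + 1 / (2 * v * a) + (1 / (2 * v * a) - 1 / (2 * v * b)) := by
        rw [hnF b hb, hnF a ha]; gcongr
    _ = 1 / (v * a) := by field_simp; ring

theorem norm_integral_exp_I_mul_sq_le {v R : ℝ} (hv : 0 < v) (hR : 0 ≤ R) :
    ‖∫ t in (0 : ℝ)..R, Complex.exp (Complex.I * (v * t ^ 2))‖ ≤ 2 * v ^ (-(1 : ℝ) / 2) := by
  set δ : ℝ := v ^ (-(1 : ℝ) / 2) with hδ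
  have hδ0 : 0 < δ := rpow_pos_of_pos hv _
  have hδv : 1 / (v * δ) = δ := by
    have h : v * (δ * δ) = 1 := by
      rw [hδ, ← rpow_add hv]
      norm_num
      rw [rpow_neg_one, mul_inv_cancel₀ hv.ne']
    field_simp
    linarith
  have hsmall : ∀ r : ℝ, 0 ≤ r →
      ‖∫ t in (0 : ℝ)..r, Complex.exp (Complex.I * (v * t ^ 2))‖ ≤ r := by
    intro r hr
    have h := intervalIntegral.norm_integral_le_of_norm_le_const (a := 0) (b := r)
      (fun t _ => (norm_exp_I_mul_sq v t).le)
    simpa [abs_of_nonneg hr] using h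
  rcases le_total R δ with h | h
  · linarith [hsmall R hR]
  · have hint := (continuous_exp_I_mul_sq v).intervalIntegrable (μ := volume)
    rw [← intervalIntegral.integral_add_adjacent_intervals (hint 0 δ) (hint δ R)]
    have h1 := norm_integral_exp_I_mul_sq_le_of_pos hv hδ0 h
    rw [hδv] at h1
    linarith [norm_add_le (∫ t in (0 : ℝ)..δ, Complex.exp (Complex.I * (v * t ^ 2)))
      (∫ t in δ..R, Complex.exp (Complex.I * (v * t ^ 2))), hsmall δ hδ0.le]

theorem integral_mul_comp_sq_eq {φ : ℝ → ℝ} (hφ : ContinuousOn φ (Ici 0)) (R : ℝ) :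
    ∫ u in (0 : ℝ)..R, φ (u ^ 2) * (2 * u) = ∫ r in (0 : ℝ)..R ^ 2, φ r := by
  have h := intervalIntegral.integral_comp_mul_deriv'' (a := 0) (b := R) (f := fun u => u ^ 2)
    (f' := fun u => 2 * u) (g := φ) (by fun_prop)
    (fun x _ => by simpa using (hasDerivAt_pow 2 x).hasDerivWithinAt) (by fun_prop)
    (hφ.mono (by rintro _ ⟨x, -, rfl⟩; exact sq_nonneg x))
  simpa using h

theorem norm_integral_exp_I_mul_sq_mul_comp_sq_le {g : ℝ → ℂ} (hg : ContDiffOn ℝ 1 g (Ici 0))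
    (hg' : IntegrableOn (fun r : ℝ => ‖derivWithin g (Ici 0) r‖) (Ioi 0)) {v R : ℝ}
    (hv : 0 < v) (hR : 0 ≤ R) :
    ‖∫ u in (0 : ℝ)..R, Complex.exp (Complex.I * (v * u ^ 2)) * g (u ^ 2)‖
      ≤ 4 * v ^ (-(1 : ℝ) / 2) *
        (‖g 0‖ + ∫ r in Ioi (0 : ℝ), ‖derivWithin g (Ici 0) r‖) := by
  set g' := derivWithin g (Ici 0)
  set V := ∫ r in Ioi (0 : ℝ), ‖g' r‖
  set e : ℝ → ℂ := fun t => Complex.exp (Complex.I * (v * t ^ 2))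
  have hcont : Continuous e := continuous_exp_I_mul_sq v
  set E : ℝ → ℂ := fun u => ∫ t in (0 : ℝ)..u, e t
  set K : ℝ := 2 * v ^ (-(1 : ℝ) / 2)
  have hK : 0 ≤ K := by positivity
  have hE : ∀ u, 0 ≤ u → ‖E u‖ ≤ K := fun u hu => norm_integral_exp_I_mul_sq_le hv hu
  have hE' : ∀ u, HasDerivAt E (e u) u := fun u =>
    hcont.integral_hasStrictDerivAt 0 u |>.hasDerivAt
  have hg'c : ContinuousOn g' (Ici 0) := hg.continuousOn_derivWithin (uniqueDiffOn_Ici 0) le_rfl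
  have hderiv : ∀ r, 0 < r → HasDerivAt g (g' r) r := fun r hr =>
    ((hg.differentiableOn one_ne_zero r hr.le).hasDerivWithinAt).hasDerivAt (Ici_mem_nhds hr)
  have hsq : ∀ {f : ℝ → ℂ}, ContinuousOn f (Ici 0) → Continuous fun u : ℝ => f (u ^ 2) := fun hf =>
    hf.comp_continuous (by fun_prop) fun u => sq_nonneg u
  set D : ℝ → ℂ := fun u => g' (u ^ 2) * (2 * u)
  have hDc : Continuous D := (hsq hg'c).mul (by fun_prop)
  have hD : ∀ u, 0 < u → HasDerivAt (fun u : ℝ => g (u ^ 2)) (D u) u := by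
    intro u hu
    have h := (hderiv (u ^ 2) (by positivity)).scomp u (hasDerivAt_pow 2 u)
    refine h.congr_deriv ?_
    simp [D, mul_comm]
  have hIV : ∀ s : ℝ, 0 ≤ s → ∫ r in (0 : ℝ)..s, ‖g' r‖ ≤ V := by
    intro s hs
    rw [intervalIntegral.integral_of_le hs]
    exact setIntegral_mono_set hg' (.of_forall fun _ => norm_nonneg _)
      Ioc_subset_Ioi_self.eventuallyLE
  have hDV : ∫ u in (0 : ℝ)..R, ‖D u‖ ≤ V := by
    refine le_trans (le_of_eq ?_) (hIV (R ^ 2) (sq_nonneg R))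
    rw [← integral_mul_comp_sq_eq hg'c.norm]
    refine intervalIntegral.integral_congr fun u hu => ?_
    rw [uIcc_of_le hR] at hu
    simp [D, abs_of_nonneg hu.1]
  have hgR : ‖g (R ^ 2)‖ ≤ ‖g 0‖ + V := by
    have h := intervalIntegral.integral_eq_sub_of_hasDerivAt_of_le hR
      (hsq hg.continuousOn).continuousOn
      (fun u hu => hD u hu.1) (hDc.intervalIntegrable 0 R)
    have h2 := (intervalIntegral.norm_integral_le_integral_norm hR (f := D) (μ := volume)).trans hDV
    rw [h] at h2
    simp only [ne_eq, OfNat.ofNat_ne_zero, not_false_eq_true, zero_pow] at h2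
    linarith [norm_le_norm_add_norm_sub' (g (R ^ 2)) (g 0)]
  have hparts := intervalIntegral.integral_mul_deriv_eq_deriv_mul_of_hasDerivAt (a := 0) (b := R)
    (u := fun u : ℝ => g (u ^ 2)) (v := E) (u' := D) (v' := e) (hsq hg.continuousOn).continuousOn
    (fun u _ => (hE' u).continuousAt.continuousWithinAt)
    (fun u hu => hD u (by simpa [hR] using hu.1)) (fun u _ => hE' u)
    (hDc.intervalIntegrable 0 R) (hcont.intervalIntegrable 0 R)
  have hE0 : E 0 = 0 := intervalIntegral.integral_same
  have hI : ‖∫ u in (0 : ℝ)..R, D u * E u‖ ≤ K * V := by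
    calc ‖∫ u in (0 : ℝ)..R, D u * E u‖ ≤ ∫ u in (0 : ℝ)..R, K * ‖D u‖ := by
          refine intervalIntegral.norm_integral_le_of_norm_le hR (.of_forall fun u hu => ?_)
            ((hDc.norm.const_mul K).intervalIntegrable 0 R)
          rw [norm_mul, mul_comm]
          gcongr
          exact hE u hu.1.le
      _ ≤ K * V := by
          rw [intervalIntegral.integral_const_mul]
          gcongr
  calc ‖∫ u in (0 : ℝ)..R, e u * g (u ^ 2)‖
      = ‖g (R ^ 2) * E R - ∫ u in (0 : ℝ)..R, D u * E u‖ := by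
        simp_rw [mul_comm (e _)]
        rw [hparts, hE0, mul_zero, sub_zero]
    _ ≤ ‖g (R ^ 2)‖ * ‖E R‖ + ‖∫ u in (0 : ℝ)..R, D u * E u‖ := by
        rw [← norm_mul]; exact norm_sub_le _ _
    _ ≤ (‖g 0‖ + V) * K + K * V := by
        gcongr
        exact hE R hR
    _ ≤ 4 * v ^ (-(1 : ℝ) / 2) * (‖g 0‖ + V) := by
        have : 0 ≤ K * ‖g 0‖ := by positivity
        rw [show 4 * v ^ (-(1 : ℝ) / 2) = 2 * K by ring]
        linarith

/-- the standard Fresnel-type bound `|∫ e^{ivu²} g(u²) du| ≲ v^{-1/2}`. -/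
theorem stmt5 :
    ∃ C : ℝ, 0 < C ∧
      ∀ g : ℝ → ℂ, ContDiffOn ℝ 1 g (Ici 0) →
        IntegrableOn (fun r : ℝ => ‖derivWithin g (Ici 0) r‖) (Ioi 0) →
        IntegrableOn (fun u : ℝ => ‖g (u ^ 2)‖) (Ioi 0) →
        ∀ v : ℝ, 0 < v →
          ‖∫ u in Ioi (0 : ℝ), Complex.exp (Complex.I * (v * u ^ 2)) * g (u ^ 2)‖
            ≤ C * v ^ (-(1 : ℝ) / 2) *
                (‖g 0‖ + ∫ r in Ioi (0 : ℝ), ‖derivWithin g (Ici 0) r‖) := by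
  refine ⟨4, by norm_num, fun g hg hg' hgi v hv => ?_⟩
  have hc : Continuous fun u : ℝ => Complex.exp (Complex.I * (v * u ^ 2)) * g (u ^ 2) :=
    (continuous_exp_I_mul_sq v).mul
      (hg.continuousOn.comp_continuous (by fun_prop) fun u => sq_nonneg u)
  have hint : IntegrableOn (fun u : ℝ => Complex.exp (Complex.I * (v * u ^ 2)) * g (u ^ 2))
      (Ioi 0) :=
    Integrable.mono' hgi hc.aestronglyMeasurable
      (.of_forall fun u => by rw [norm_mul, norm_exp_I_mul_sq, one_mul])
  refine le_of_tendsto (intervalIntegral_tendsto_integral_Ioi 0 hint Filter.tendsto_id).norm ?_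
  filter_upwards [Filter.eventually_ge_atTop 0] with R hR
  exact norm_integral_exp_I_mul_sq_mul_comp_sq_le hg hg' hv hR
end

section
/- Let l ≥ 1 be an integer, m ≥ 0 and s integers with 0 ≤ s ≤ l−1, p ≥ 0 an integer, M > 0, and a ≥ 0. Let κ : ℝ^l → ℂ be smooth with |∂^k κ(λ)| ≤ M (1+|λ|)^{p} for all λ ∈ ℝ^l and all multi-indices k with |k| ≤ m, and suppose κ(λ) = |λ|^a κ₁(λ) for a smooth function κ₁ : ℝ^l → ℂ. Define f(r) := ∫_{|λ|=r} κ(λ) dS(λ), the integral of κ over the sphere of radius r with respect to its (l−1)-dimensional surface measure. Then there is a constant C_{l,m} > 0 depending only on l and m such that for all r > 0, | d^m/dr^m ( r^{−s} f(r) ) | ≤ C_{l,m} M (1+r)^{l−1−s+p}, and moreover there is a constant C > 0 (depending on l, m, s, a and κ₁) such that | d^m/dr^m ( r^{−s} f(r) ) | ≤ C r^{l−1−s−m+a} for all 0 < r ≤ 1. -/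
open MeasureTheory Set Real

section SphericalMean

variable {E F : Type*} [NormedAddCommGroup E] [NormedSpace ℝ E] [FiniteDimensional ℝ E]
  [MeasurableSpace E] [BorelSpace E] [NormedAddCommGroup F] [NormedSpace ℝ F]
  {μ : Measure (Metric.sphere (0 : E) 1)} [IsFiniteMeasure μ] {κ : E → F}

/-- Differentiation under the integral sign for the directional derivatives of `κ` averaged over
the unit sphere. -/
theorem hasDerivAt_sphericalMean_iteratedFDeriv (hκ : ContDiff ℝ (⊤ : ℕ∞) κ) (i : ℕ) (r : ℝ) :
    HasDerivAt (fun t : ℝ ↦ ∫ ω, iteratedFDeriv ℝ i κ (t • (ω : E)) (fun _ ↦ (ω : E)) ∂μ)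
      (∫ ω, iteratedFDeriv ℝ (i + 1) κ (r • (ω : E)) (fun _ ↦ (ω : E)) ∂μ) r := by
  have hcont (j : ℕ) (t : ℝ) : Continuous fun ω : Metric.sphere (0 : E) 1 ↦
      iteratedFDeriv ℝ j κ (t • (ω : E)) (fun _ ↦ (ω : E)) := by
    have h := hκ.continuous_iteratedFDeriv (m := j) (mod_cast le_top)
    fun_prop
  have : ProperSpace E := FiniteDimensional.proper ℝ E
  have : CompactSpace (Metric.sphere (0 : E) 1) :=
    isCompact_iff_compactSpace.1 (isCompact_sphere 0 1)
  have hint (j : ℕ) (t : ℝ) : Integrable (fun ω : Metric.sphere (0 : E) 1 ↦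
      iteratedFDeriv ℝ j κ (t • (ω : E)) (fun _ ↦ (ω : E))) μ :=
    (hcont j t).integrable_of_hasCompactSupport (HasCompactSupport.of_compactSpace _)
  obtain ⟨B, hB⟩ := (isCompact_closedBall (0 : E) (|r| + 1)).exists_bound_of_continuousOn
    (hκ.continuous_iteratedFDeriv (m := i + 1) (mod_cast le_top)).continuousOn
  refine (hasDerivAt_integral_of_dominated_loc_of_deriv_le
    (F' := fun t (ω : Metric.sphere (0 : E) 1) ↦
      iteratedFDeriv ℝ (i + 1) κ (t • (ω : E)) (fun _ ↦ (ω : E)))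
    (bound := fun _ ↦ B) (Metric.ball_mem_nhds r one_pos)
    (.of_forall fun t ↦ (hint i t).aestronglyMeasurable) (hint i r)
    (hint (i + 1) r).aestronglyMeasurable (.of_forall fun ω t ht ↦ ?_)
    (integrable_const B) (.of_forall fun ω t _ ↦ ?_)).2
  · have hω : ‖(ω : E)‖ = 1 := by simp
    refine ((iteratedFDeriv ℝ (i + 1) κ (t • (ω : E))).le_opNorm _).trans ?_
    simp only [hω, Finset.prod_const_one, mul_one]
    refine hB _ ?_
    have h1 : |t - r| < 1 := by simpa [Real.dist_eq] using ht
    have h2 := abs_sub_abs_le_abs_sub t r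
    simp only [Metric.mem_closedBall, dist_zero_right, norm_smul, hω, Real.norm_eq_abs]
    linarith
  · have hd : DifferentiableAt ℝ (iteratedFDeriv ℝ i κ) (t • (ω : E)) :=
      (hκ.differentiable_iteratedFDeriv (m := i) (mod_cast ENat.natCast_lt_top i)) _
    have h1 : HasDerivAt (fun t : ℝ ↦ t • (ω : E)) (ω : E) t := by
      simpa using (hasDerivAt_id t).smul_const (ω : E)
    have h2 := hd.hasFDerivAt.comp_hasDerivAt t h1
    exact ((ContinuousMultilinearMap.apply ℝ (fun _ : Fin i ↦ E) F
      (fun _ ↦ (ω : E))).hasFDerivAt.comp_hasDerivAt t h2)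

theorem iteratedDeriv_sphericalMean (hκ : ContDiff ℝ (⊤ : ℕ∞) κ) (i : ℕ) :
    iteratedDeriv i (fun t : ℝ ↦ ∫ ω, κ (t • (ω : E)) ∂μ) =
      fun t ↦ ∫ ω, iteratedFDeriv ℝ i κ (t • (ω : E)) (fun _ ↦ (ω : E)) ∂μ := by
  induction i with
  | zero => simp
  | succ i ih =>
    rw [iteratedDeriv_succ, ih]
    exact funext fun t ↦ (hasDerivAt_sphericalMean_iteratedFDeriv hκ i t).deriv

theorem contDiff_sphericalMean (hκ : ContDiff ℝ (⊤ : ℕ∞) κ) :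
    ContDiff ℝ (⊤ : ℕ∞) (fun t : ℝ ↦ ∫ ω, κ (t • (ω : E)) ∂μ) :=
  contDiff_of_differentiable_iteratedDeriv fun i _ ↦ by
    rw [iteratedDeriv_sphericalMean hκ i]
    exact fun t ↦ (hasDerivAt_sphericalMean_iteratedFDeriv hκ i t).differentiableAt

theorem norm_iteratedDeriv_sphericalMean_le (hκ : ContDiff ℝ (⊤ : ℕ∞) κ) {i : ℕ} {r B : ℝ}
    (hB : ∀ ω : Metric.sphere (0 : E) 1, ‖iteratedFDeriv ℝ i κ (r • (ω : E))‖ ≤ B) :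
    ‖iteratedDeriv i (fun t : ℝ ↦ ∫ ω, κ (t • (ω : E)) ∂μ) r‖ ≤ B * μ.real univ := by
  rw [iteratedDeriv_sphericalMean hκ i]
  refine norm_integral_le_of_norm_le_const (.of_forall fun ω ↦ ?_)
  refine ((iteratedFDeriv ℝ i κ (r • (ω : E))).le_opNorm _).trans ?_
  simpa using hB ω

end SphericalMean

/-- Leibniz bound on the open half-line, for the product of a real function and a vector-valued
function. -/
theorem norm_iteratedDeriv_smul_le_of_pos {F : Type*} [NormedAddCommGroup F] [NormedSpace ℝ F]
    {w : ℝ → ℝ} {G : ℝ → F} {m : ℕ} {r : ℝ} (hw : ContDiffOn ℝ m w (Ioi 0))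
    (hG : ContDiffOn ℝ m G (Ioi 0)) (hr : 0 < r) :
    ‖iteratedDeriv m (fun t ↦ w t • G t) r‖ ≤ ∑ i ∈ Finset.range (m + 1),
      (m.choose i : ℝ) * ‖iteratedDeriv i w r‖ * ‖iteratedDeriv (m - i) G r‖ := by
  have h := norm_iteratedFDerivWithin_smul_le hw hG isOpen_Ioi.uniqueDiffOn hr le_rfl
  simpa only [iteratedFDerivWithin_of_isOpen _ isOpen_Ioi (show r ∈ Ioi (0 : ℝ) from hr),
    norm_iteratedFDeriv_eq_norm_iteratedDeriv] using h

theorem stmt7 (l m : ℕ) (hl : 1 ≤ l) :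
    ∃ Clm : ℝ, 0 < Clm ∧
      ∀ (s p : ℕ), s ≤ l - 1 → ∀ (M a : ℝ), 0 < M → 0 ≤ a →
        ∀ κ κ₁ : EuclideanSpace ℝ (Fin l) → ℂ,
          ContDiff ℝ (⊤ : ℕ∞) κ → ContDiff ℝ (⊤ : ℕ∞) κ₁ →
          (∀ k : ℕ, k ≤ m → ∀ lam : EuclideanSpace ℝ (Fin l),
            ‖iteratedFDeriv ℝ k κ lam‖ ≤ M * (1 + ‖lam‖) ^ p) →
          (∀ lam : EuclideanSpace ℝ (Fin l), κ lam = (‖lam‖ ^ a : ℝ) * κ₁ lam) →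
          (∀ r : ℝ, 0 < r →
            ‖iteratedDeriv m (fun r' : ℝ => (r' : ℂ) ^ (-(s : ℤ)) *
                ((r' : ℂ) ^ (l - 1) *
                  ∫ ω : Metric.sphere (0 : EuclideanSpace ℝ (Fin l)) 1,
                    κ (r' • (ω : EuclideanSpace ℝ (Fin l)))
                    ∂((volume : Measure (EuclideanSpace ℝ (Fin l))).toSphere))) r‖
              ≤ Clm * M * (1 + r) ^ (l - 1 - s + p)) ∧
          (∃ C : ℝ, 0 < C ∧ ∀ r : ℝ, 0 < r → r ≤ 1 →
            ‖iteratedDeriv m (fun r' : ℝ => (r' : ℂ) ^ (-(s : ℤ)) *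
                ((r' : ℂ) ^ (l - 1) *
                  ∫ ω : Metric.sphere (0 : EuclideanSpace ℝ (Fin l)) 1,
                    κ (r' • (ω : EuclideanSpace ℝ (Fin l)))
                    ∂((volume : Measure (EuclideanSpace ℝ (Fin l))).toSphere))) r‖
              ≤ C * r ^ ((l : ℝ) - 1 - s - m + a)) := by
  set μ := (volume : Measure (EuclideanSpace ℝ (Fin l))).toSphere
  have hS : 0 ≤ ∑ i ∈ Finset.range (m + 1), (m.choose i : ℝ) * (l : ℝ) ^ i * μ.real univ :=
    Finset.sum_nonneg fun i _ ↦ by positivity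
  refine ⟨(∑ i ∈ Finset.range (m + 1), (m.choose i : ℝ) * (l : ℝ) ^ i * μ.real univ) + 1,
    by linarith, ?_⟩
  intro s p hs M a hM ha κ κ₁ hκ hκ₁ hbound hfac
  obtain ⟨n, hn⟩ : ∃ n, l - 1 = s + n := Nat.exists_eq_add_of_le hs
  have hnl : l - 1 - s = n := by omega
  have hweight (t : ℝ) (ht : 0 < t) (z : ℂ) :
      (t : ℂ) ^ (-(s : ℤ)) * ((t : ℂ) ^ (l - 1) * z) = (t ^ n) • z := by
    have ht' : (t : ℂ) ≠ 0 := by exact_mod_cast ht.ne'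
    rw [hn, pow_add, zpow_neg, zpow_natCast, Complex.real_smul]
    push_cast
    field_simp
  rw [hnl]
  refine ⟨fun r hr ↦ ?_, ?_⟩
  · rw [Filter.EventuallyEq.iteratedDeriv_eq (g := fun t : ℝ ↦ (t ^ n) •
      ∫ ω, κ (t • (ω : EuclideanSpace ℝ (Fin l))) ∂μ) m
      ((eventually_gt_nhds hr).mono fun t ht ↦ hweight t ht _)]
    refine (norm_iteratedDeriv_smul_le_of_pos (contDiff_id.pow n).contDiffOn
      ((contDiff_sphericalMean hκ).of_le (mod_cast le_top)).contDiffOn hr).trans ?_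
    have hterm : ∀ i ∈ Finset.range (m + 1),
        (m.choose i : ℝ) * ‖iteratedDeriv i (fun t : ℝ ↦ t ^ n) r‖ *
          ‖iteratedDeriv (m - i) (fun t : ℝ ↦
            ∫ ω, κ (t • (ω : EuclideanSpace ℝ (Fin l))) ∂μ) r‖ ≤
        (m.choose i : ℝ) * (l : ℝ) ^ i * μ.real univ * (M * (1 + r) ^ (n + p)) := by
      intro i _
      have h1 : ‖iteratedDeriv i (fun t : ℝ ↦ t ^ n) r‖ ≤ (l : ℝ) ^ i * (1 + r) ^ n := by
        rw [iteratedDeriv_pow, norm_mul, norm_pow, Real.norm_of_nonneg hr.le,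
          Real.norm_of_nonneg (Nat.cast_nonneg _)]
        gcongr ?_ * ?_
        · exact_mod_cast (Nat.descFactorial_le_pow n i).trans
            (Nat.pow_le_pow_left (by omega) i)
        · calc r ^ (n - i) ≤ (1 + r) ^ (n - i) := by gcongr; linarith
            _ ≤ (1 + r) ^ n := pow_le_pow_right₀ (by linarith) (Nat.sub_le n i)
      have h2 := norm_iteratedDeriv_sphericalMean_le (μ := μ) hκ (i := m - i) (r := r)
        (B := M * (1 + r) ^ p) fun ω ↦ by
          simpa [norm_smul, abs_of_pos hr] using
            hbound (m - i) (Nat.sub_le m i) (r • (ω : EuclideanSpace ℝ (Fin l)))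
      calc _ ≤ (m.choose i : ℝ) * ((l : ℝ) ^ i * (1 + r) ^ n) *
            (M * (1 + r) ^ p * μ.real univ) := by gcongr
        _ = _ := by ring
    refine (Finset.sum_le_sum hterm).trans ?_
    rw [← Finset.sum_mul, mul_assoc]
    gcongr
    linarith
  · set G : ℝ → ℂ := fun t ↦ ∫ ω, κ₁ (t • (ω : EuclideanSpace ℝ (Fin l))) ∂μ with hG
    have hGsmooth : ContDiff ℝ (⊤ : ℕ∞) G := contDiff_sphericalMean hκ₁
    choose K hK using fun j : ℕ ↦
      (isCompact_Icc (a := (0 : ℝ)) (b := 1)).exists_bound_of_continuousOn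
      (hGsmooth.continuous_iteratedDeriv j (mod_cast le_top)).continuousOn
    set b : ℝ := n + a with hb
    have hb' : (l : ℝ) - 1 - s - m + a = b - m := by
      have : (l : ℝ) = s + n + 1 := by exact_mod_cast (show l = s + n + 1 by omega)
      rw [hb, this]; ring
    have hK0 (j : ℕ) : 0 ≤ K j := (norm_nonneg _).trans (hK j 0 (by simp))
    have hS' : 0 ≤ ∑ i ∈ Finset.range (m + 1),
        (m.choose i : ℝ) * ‖(descPochhammer ℝ i).eval b‖ * K (m - i) :=
      Finset.sum_nonneg fun i _ ↦ by have := hK0 (m - i); positivity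
    refine ⟨(∑ i ∈ Finset.range (m + 1),
      (m.choose i : ℝ) * ‖(descPochhammer ℝ i).eval b‖ * K (m - i)) + 1, by linarith,
      fun r hr hr1 ↦ ?_⟩
    have heq (t : ℝ) (ht : 0 < t) : (t : ℂ) ^ (-(s : ℤ)) * ((t : ℂ) ^ (l - 1) *
        ∫ ω, κ (t • (ω : EuclideanSpace ℝ (Fin l))) ∂μ) = (t ^ b) • G t := by
      have h1 : ∫ ω, κ (t • (ω : EuclideanSpace ℝ (Fin l))) ∂μ = (t ^ a) • G t := by
        rw [hG, ← integral_smul]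
        refine integral_congr_ae (.of_forall fun ω ↦ ?_)
        simp [hfac, norm_smul, abs_of_pos ht]
      rw [hweight t ht, h1, smul_smul, hb, Real.rpow_add ht, Real.rpow_natCast]
    rw [Filter.EventuallyEq.iteratedDeriv_eq m
      ((eventually_gt_nhds hr).mono fun t ht ↦ heq t ht), hb']
    have hw : ContDiffOn ℝ m (fun t : ℝ ↦ t ^ b) (Ioi 0) := fun t ht ↦
      (Real.contDiffAt_rpow_const_of_ne (ne_of_gt ht)).contDiffWithinAt
    refine (norm_iteratedDeriv_smul_le_of_pos hw
      (hGsmooth.of_le (mod_cast le_top)).contDiffOn hr).trans ?_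
    have hterm : ∀ i ∈ Finset.range (m + 1),
        (m.choose i : ℝ) * ‖iteratedDeriv i (fun t : ℝ ↦ t ^ b) r‖ *
          ‖iteratedDeriv (m - i) G r‖ ≤
        (m.choose i : ℝ) * ‖(descPochhammer ℝ i).eval b‖ * K (m - i) * r ^ (b - m) := by
      intro i hi
      have hi' : (i : ℝ) ≤ m := by exact_mod_cast Finset.mem_range_succ_iff.1 hi
      have h1 : ‖iteratedDeriv i (fun t : ℝ ↦ t ^ b) r‖ ≤
          ‖(descPochhammer ℝ i).eval b‖ * r ^ (b - m) := by
        rw [iteratedDeriv_eq_iterate, Real.iter_deriv_rpow_const, norm_mul,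
          Real.norm_of_nonneg (Real.rpow_nonneg hr.le _)]
        exact mul_le_mul_of_nonneg_left
          (Real.rpow_le_rpow_of_exponent_ge hr hr1 (by linarith)) (norm_nonneg _)
      calc _ ≤ (m.choose i : ℝ) * (‖(descPochhammer ℝ i).eval b‖ * r ^ (b - m)) * K (m - i) := by
            have := hK (m - i) r ⟨hr.le, hr1⟩
            gcongr
        _ = _ := by ring
    refine (Finset.sum_le_sum hterm).trans ?_
    rw [← Finset.sum_mul]
    gcongr
    linarith
end

section
/- Let p ≥ 0, a ≥ 0, b ≥ 0, n ≥ l ≥ 1 and k ≥ 1 be integers. Let g : [0,∞) → ℂ be smooth with d^m/dr^m g(0) = 0 for all 0 ≤ m < a, and suppose that for every integer m with 0 ≤ m ≤ min(p, a+b+1) there is a constant A_m with | d^m/dr^m ( r^b g(r) ) | ≤ A_m (1+r)^{n−l+b+k} for all r ≥ 0. Let ψ : [0,∞) → ℂ be p times continuously differentiable with ∫₀^∞ |ψ^{(j)}(r)| (1+r)^{n−l+b+k} dr < ∞ for all 0 ≤ j ≤ p. Then for every integer m with 0 ≤ m ≤ min(p, a+b+1) there is a constant C_m > 0 (depending on the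 A_j, on ψ and on m) such that for every nonzero v ∈ ℝ, | ∫₀^∞ e^{i v r} ψ(r) r^b g(r) dr | ≤ C_m |v|^{−m}. -/
open MeasureTheory Set Real

/-- A smooth phase of modulus one does not affect integrability. -/
lemma integrableOn_exp_I_mul {s : Set ℝ} {h : ℝ → ℂ} (hi : IntegrableOn h s) (v : ℝ) :
    IntegrableOn (fun r : ℝ => Complex.exp (Complex.I * (v * r)) * h r) s := by
  refine (integrable_norm_iff ?_).1 ?_
  · exact (Continuous.aestronglyMeasurable (by fun_prop)).mul hi.aestronglyMeasurable
  · refine hi.norm.congr (.of_forall fun r => ?_)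
    simp [Complex.norm_exp]

lemma norm_integral_exp_I_mul_le (s : Set ℝ) (h : ℝ → ℂ) (v : ℝ) :
    ‖∫ r in s, Complex.exp (Complex.I * (v * r)) * h r‖ ≤ ∫ r in s, ‖h r‖ := by
  refine (norm_integral_le_integral_norm _).trans_eq (integral_congr_ae (.of_forall fun r => ?_))
  simp [Complex.norm_exp]

/-- Integration by parts against `exp (i v r)` on the half line. -/
lemma I_mul_integral_exp_I_mul {h h' : ℝ → ℂ} (hc : ContinuousWithinAt h (Ici 0) 0)
    (hd : ∀ x ∈ Ioi (0 : ℝ), HasDerivAt h (h' x) x)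
    (hi : IntegrableOn h (Ioi 0)) (hi' : IntegrableOn h' (Ioi 0)) (v : ℝ) :
    Complex.I * v * ∫ r in Ioi (0 : ℝ), Complex.exp (Complex.I * (v * r)) * h r =
      -h 0 - ∫ r in Ioi (0 : ℝ), Complex.exp (Complex.I * (v * r)) * h' r := by
  have he : ∀ x : ℝ, HasDerivAt (fun r : ℝ => Complex.exp (Complex.I * (v * r)))
      (Complex.exp (Complex.I * (v * x)) * (Complex.I * v)) x := fun x => by
    have := (((hasDerivAt_id x).ofReal_comp.const_mul (v : ℂ)).const_mul Complex.I).cexp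
    simpa using this
  have hd' : ∀ x ∈ Ioi (0 : ℝ), HasDerivAt
      (fun r : ℝ => Complex.exp (Complex.I * (v * r)) * h r)
      (Complex.I * v * (Complex.exp (Complex.I * (v * x)) * h x)
        + Complex.exp (Complex.I * (v * x)) * h' x) x := fun x hx => by
    refine ((he x).mul (hd x hx)).congr_deriv ?_
    ring
  have h1 := integrableOn_exp_I_mul hi v
  have h2 := integrableOn_exp_I_mul hi' v
  have h3 := (h1.const_mul (Complex.I * v)).add h2
  have hlim := tendsto_zero_of_hasDerivAt_of_integrableOn_Ioi hd' h3 h1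
  have key := integral_Ioi_of_hasDerivAt_of_tendsto
    ((he 0).continuousAt.continuousWithinAt.mul hc) hd' h3 hlim
  rw [integral_add (h1.const_mul _) h2, integral_const_mul] at key
  simp only [Pi.mul_apply, Complex.ofReal_zero, mul_zero, Complex.exp_zero, one_mul,
    zero_sub] at key
  rw [← key]
  ring

/-- Decay of order `m` of the half-line Fourier integral of a function whose derivatives of order
at most `m` are integrable and whose derivatives of order less than `m - 1` vanish at `0`. -/
lemma exists_norm_integral_exp_I_mul_mul_pow_le {m : ℕ} {h : ℝ → ℂ}
    (hC : ContDiffOn ℝ m h (Ici 0))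
    (hint : ∀ j ≤ m, IntegrableOn (iteratedDerivWithin j h (Ici 0)) (Ioi 0))
    (h0 : ∀ j, j + 1 < m → iteratedDerivWithin j h (Ici 0) 0 = 0) :
    ∃ C : ℝ, ∀ v : ℝ,
      ‖∫ r in Ioi (0 : ℝ), Complex.exp (Complex.I * (v * r)) * h r‖ * |v| ^ m ≤ C := by
  induction m generalizing h with
  | zero =>
    refine ⟨∫ r in Ioi (0 : ℝ), ‖h r‖, fun v => ?_⟩
    simpa using norm_integral_exp_I_mul_le (Ioi 0) h v
  | succ m ih =>
    have hu : UniqueDiffOn ℝ (Ici (0 : ℝ)) := uniqueDiffOn_Ici 0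
    obtain ⟨C, hCv⟩ := ih (h := derivWithin h (Ici 0)) (hC.derivWithin hu (by norm_cast))
      (fun j hj => by simpa only [iteratedDerivWithin_succ'] using hint (j + 1) (by omega))
      (fun j hj => by simpa only [iteratedDerivWithin_succ'] using h0 (j + 1) (by omega))
    refine ⟨‖h 0‖ + C, fun v => ?_⟩
    have hdiff : DifferentiableOn ℝ h (Ici 0) := hC.differentiableOn (by simp)
    have key := I_mul_integral_exp_I_mul (h := h) (h' := derivWithin h (Ici 0))
      (hdiff 0 self_mem_Ici).continuousWithinAt
      (fun x hx => (hdiff x (Ioi_subset_Ici_self hx)).hasDerivWithinAt.hasDerivAt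
        (Ici_mem_nhds hx))
      (by simpa using hint 0 (by omega))
      (by simpa only [iteratedDerivWithin_one] using hint 1 (by omega)) v
    have hbd : ‖h 0‖ * |v| ^ m ≤ ‖h 0‖ := by
      rcases Nat.eq_zero_or_pos m with rfl | hm
      · simp
      · have : h 0 = 0 := by simpa using h0 0 (by omega)
        simp [this]
    have hnorm := congrArg norm key
    rw [norm_mul, norm_mul, Complex.norm_I, one_mul, Complex.norm_real, Real.norm_eq_abs] at hnorm
    calc _ = (|v| * ‖∫ r in Ioi (0 : ℝ), Complex.exp (Complex.I * (v * r)) * h r‖) * |v| ^ m := by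
          ring
      _ ≤ (‖h 0‖ + ‖∫ r in Ioi (0 : ℝ), Complex.exp (Complex.I * (v * r)) *
            derivWithin h (Ici 0) r‖) * |v| ^ m := by
          rw [hnorm]
          gcongr
          exact (norm_sub_le _ _).trans_eq (by rw [norm_neg])
      _ ≤ ‖h 0‖ + C := by
          rw [add_mul]
          exact add_le_add hbd (hCv v)

/-- Multiplying by `r ^ b` raises the order of vanishing at `0` by `b`. -/
lemma iteratedDerivWithin_pow_mul_apply_zero {a b j : ℕ} {g : ℝ → ℂ}
    (hg : ContDiffOn ℝ j g (Ici 0))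
    (hg0 : ∀ m < a, iteratedDerivWithin m g (Ici 0) 0 = 0) (hj : j < a + b) :
    iteratedDerivWithin j (fun r : ℝ => (r : ℂ) ^ b * g r) (Ici 0) 0 = 0 := by
  have hu : UniqueDiffOn ℝ (Ici (0 : ℝ)) := uniqueDiffOn_Ici 0
  have h0 : (0 : ℝ) ∈ Ici (0 : ℝ) := self_mem_Ici
  have : (fun r : ℝ => (r : ℂ) ^ b * g r) = (fun r : ℝ => r ^ b) • g := by
    ext r
    simp
  rw [this, iteratedDerivWithin_smul h0 hu (by fun_prop) (hg 0 h0)]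
  refine Finset.sum_eq_zero fun i hi_mem => ?_
  have hij : i < j + 1 := Finset.mem_range.1 hi_mem
  rw [iteratedDerivWithin_pow h0 hu]
  rcases lt_trichotomy i b with hi | rfl | hi
  · simp [zero_pow (Nat.sub_ne_zero_of_lt hi)]
  · rw [hg0 (j - i) (by omega), smul_zero, smul_zero]
  · simp [Nat.descFactorial_of_lt hi]

/-- The derivatives of `ψ * G` are integrable when those of `G` are dominated by a weight against
which those of `ψ` are integrable. -/
lemma integrableOn_iteratedDerivWithin_mul {j : ℕ} {ψ G : ℝ → ℂ} {w : ℝ → ℝ}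
    (hψ : ContDiffOn ℝ j ψ (Ici 0)) (hG : ContDiffOn ℝ j G (Ici 0))
    (hψint : ∀ i ≤ j, IntegrableOn
      (fun r => ‖iteratedDerivWithin i ψ (Ici 0) r‖ * w r) (Ioi 0))
    (hGb : ∀ i ≤ j, ∃ A : ℝ, ∀ r : ℝ, 0 ≤ r → ‖iteratedDerivWithin i G (Ici 0) r‖ ≤ A * w r) :
    IntegrableOn (iteratedDerivWithin j (ψ * G) (Ici 0)) (Ioi 0) := by
  have hu : UniqueDiffOn ℝ (Ici (0 : ℝ)) := uniqueDiffOn_Ici 0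
  have hsum : IntegrableOn (fun r => ∑ i ∈ Finset.range (j + 1),
      (j.choose i : ℂ) * iteratedDerivWithin i ψ (Ici 0) r *
        iteratedDerivWithin (j - i) G (Ici 0) r) (Ioi 0) := by
    refine integrable_finsetSum _ fun i hi => ?_
    have hij : i ≤ j := Nat.lt_succ_iff.1 (Finset.mem_range.1 hi)
    obtain ⟨A, hA⟩ := hGb (j - i) (Nat.sub_le _ _)
    simp only [mul_assoc]
    refine Integrable.const_mul ?_ _
    refine ((hψint i hij).const_mul A).mono' ?_ ?_
    · refine ContinuousOn.aestronglyMeasurable ?_ measurableSet_Ioi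
      exact ((hψ.continuousOn_iteratedDerivWithin (by exact_mod_cast hij) hu).mul
        (hG.continuousOn_iteratedDerivWithin (by exact_mod_cast Nat.sub_le j i) hu)).mono
          Ioi_subset_Ici_self
    · refine (ae_restrict_iff' measurableSet_Ioi).2 (.of_forall fun r hr => ?_)
      rw [norm_mul]
      calc _ ≤ ‖iteratedDerivWithin i ψ (Ici 0) r‖ * (A * w r) := by
            gcongr
            exact hA r (le_of_lt hr)
        _ = _ := by ring
  refine hsum.congr_fun (fun r hr => ?_) measurableSet_Ioi
  have hr' : r ∈ Ici (0 : ℝ) := Ioi_subset_Ici_self hr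
  exact (iteratedDerivWithin_mul hr' hu (hψ r hr') (hG r hr')).symm

open MeasureTheory Set Real

/-- non-stationary phase bound `|∫ e^{ivr} ψ(r) r^b g(r) dr| ≤ C_m |v|^{−m}`. -/
theorem stmt9 (p a b n l k : ℕ) (hl : 1 ≤ l) (hn : l ≤ n) (hk : 1 ≤ k)
    (g : ℝ → ℂ) (hg : ContDiffOn ℝ (⊤ : ℕ∞) g (Ici 0))
    (hg0 : ∀ m : ℕ, m < a → iteratedDerivWithin m g (Ici 0) 0 = 0)
    (hgb : ∀ m : ℕ, m ≤ min p (a + b + 1) → ∃ A : ℝ,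
      ∀ r : ℝ, 0 ≤ r →
        ‖iteratedDerivWithin m (fun r' : ℝ => (r' : ℂ) ^ b * g r') (Ici 0) r‖
          ≤ A * (1 + r) ^ (n - l + b + k))
    (ψ : ℝ → ℂ) (hψ : ContDiffOn ℝ p ψ (Ici 0))
    (hψint : ∀ j : ℕ, j ≤ p →
      IntegrableOn (fun r : ℝ => ‖iteratedDerivWithin j ψ (Ici 0) r‖ *
        (1 + r) ^ (n - l + b + k)) (Ioi 0)) :
    ∀ m : ℕ, m ≤ min p (a + b + 1) →
      ∃ C : ℝ, 0 < C ∧ ∀ v : ℝ, v ≠ 0 →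
        ‖∫ r in Ioi (0 : ℝ), Complex.exp (Complex.I * (v * r)) * ψ r * (r : ℂ) ^ b * g r‖
          ≤ C * |v| ^ (-(m : ℝ)) := by
  intro m hm
  have hu : UniqueDiffOn ℝ (Ici (0 : ℝ)) := uniqueDiffOn_Ici 0
  have h0 : (0 : ℝ) ∈ Ici (0 : ℝ) := self_mem_Ici
  have hmp : m ≤ p := hm.trans (min_le_left _ _)
  have hmab : m ≤ a + b + 1 := hm.trans (min_le_right _ _)
  have hgj : ∀ j : ℕ, ContDiffOn ℝ j g (Ici 0) := fun j =>
    hg.of_le (by exact_mod_cast le_top)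
  have hψj : ∀ j ≤ m, ContDiffOn ℝ j ψ (Ici 0) := fun j hj =>
    hψ.of_le (by exact_mod_cast hj.trans hmp)
  have hG : ∀ j : ℕ, ContDiffOn ℝ j (fun r : ℝ => (r : ℂ) ^ b * g r) (Ici 0) := fun j =>
    (Complex.ofRealCLM.contDiff.pow b).contDiffOn.mul (hgj j)
  obtain ⟨C, hC⟩ := exists_norm_integral_exp_I_mul_mul_pow_le
    (h := ψ * fun r : ℝ => (r : ℂ) ^ b * g r) ((hψj m le_rfl).mul (hG m))
    (fun j hj => integrableOn_iteratedDerivWithin_mul (hψj j hj) (hG j)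
      (fun i hi => hψint i (by omega)) (fun i hi => hgb i (by omega)))
    (fun j hj => by
      rw [iteratedDerivWithin_mul h0 hu (hψj j (by omega) 0 h0) (hG j 0 h0)]
      refine Finset.sum_eq_zero fun i _ => ?_
      rw [iteratedDerivWithin_pow_mul_apply_zero (hgj _) hg0 (by omega), mul_zero])
  refine ⟨max C 1, by positivity, fun v hv => ?_⟩
  rw [Real.rpow_neg (abs_nonneg v), Real.rpow_natCast, ← div_eq_mul_inv,
    le_div_iff₀ (by positivity)]
  simpa only [Pi.mul_apply, mul_assoc] using (hC v).trans (le_max_left C 1)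
end

section
/- Let l ≥ 2 and n ≥ l be integers and let ς : ℝ^l → ℂ be smooth such that for every multi-index μ there is a constant C_μ with |∂^μ ς(λ)| ≤ C_μ (1+|λ|)^{n−l} for all λ ∈ ℝ^l. For r ≥ 0 and θ ∈ [0,π] define D_r(θ) = ∫_{S^{l−2}} ς( r (cos θ, (sin θ) ω) ) dω, where the integral is over the unit sphere S^{l−2} ⊂ ℝ^{l−1} with its surface measure (for l = 2, S^0 = {±1} with counting measure). Then for every integer m ≥ 1 there is a constant C_{l,m} > 0 such that for all r ≥ 0 and θ ∈ [0,π], | d^m/dθ^m D_r(θ) | ≤ C_{l,m} r (1+r)^{n−l+m−1}. -/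
open MeasureTheory Set Real

/-- The spherical mean `D_r(θ) = ∫_{S^{l−2}} ς(r(cos θ, (sin θ)ω)) dω` on `ℝ^l`,
where `l = l' + 2 ≥ 2`. -/
noncomputable def Dfun (l' : ℕ) (ς : EuclideanSpace ℝ (Fin (l' + 2)) → ℂ) (r θ : ℝ) : ℂ :=
  ∫ ω : Metric.sphere (0 : EuclideanSpace ℝ (Fin (l' + 1))) 1,
    ς ((EuclideanSpace.equiv (Fin (l' + 2)) ℝ).symm
        (Fin.cons (r * Real.cos θ)
          (fun j : Fin (l' + 1) =>
            r * Real.sin θ * (ω : EuclideanSpace ℝ (Fin (l' + 1))) j)))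
    ∂((volume : Measure (EuclideanSpace ℝ (Fin (l' + 1)))).toSphere)

/-- Differentiation under the integral sign for a smooth integrand on a compact space. -/
theorem hasDerivAt_integral_of_contDiff_of_compact {P X F : Type*}
    [NormedAddCommGroup P] [NormedSpace ℝ P] [NormedAddCommGroup F] [NormedSpace ℝ F]
    [TopologicalSpace X] [CompactSpace X] [SecondCountableTopology X]
    [MeasurableSpace X] [OpensMeasurableSpace X] (ν : Measure X) [IsFiniteMeasure ν]
    {p : X → P} (hp : Continuous p) {f : P → ℝ → F}
    (hf : ContDiff ℝ 1 (Function.uncurry f)) (t : ℝ) :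
    HasDerivAt (fun t => ∫ x, f (p x) t ∂ν) (∫ x, deriv (f (p x)) t ∂ν) t := by
  have hpt : Continuous fun q : X × ℝ => (p q.1, q.2) := by fun_prop
  have hderiv : Continuous fun q : X × ℝ => deriv (f (p q.1)) q.2 := by
    simp_rw [← fderiv_apply_one_eq_deriv]
    exact (ContDiff.fderiv_apply (n := 0) (m := 1) (f := fun y : P × ℝ => f y.1)
      (g := fun y => y.2) (k := fun _ => (1 : ℝ)) (hf.comp ((contDiff_fst.comp contDiff_fst).prodMk contDiff_snd))
      contDiff_snd contDiff_const (by simp)).continuous.comp hpt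
  have hsection (s : ℝ) : Continuous fun x => f (p x) s :=
    hf.continuous.comp (by fun_prop : Continuous fun x => (p x, s))
  obtain ⟨C, hC⟩ := ((isCompact_univ (X := X)).prod
    (isCompact_closedBall t 1)).exists_bound_of_continuousOn hderiv.continuousOn
  refine (hasDerivAt_integral_of_dominated_loc_of_deriv_le (F := fun s x => f (p x) s)
    (F' := fun s x => deriv (f (p x)) s) (bound := fun _ => C)
    (Metric.closedBall_mem_nhds t one_pos) ?_ ?_ ?_ ?_ (integrable_const _) ?_).2
  · exact .of_forall fun s => (hsection s).stronglyMeasurable_of_hasCompactSupport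
      (HasCompactSupport.of_compactSpace _) |>.aestronglyMeasurable
  · exact (hsection t).integrable_of_hasCompactSupport (HasCompactSupport.of_compactSpace _)
  · exact ((hderiv.comp (by fun_prop : Continuous fun x : X => (x, t)))
      |>.stronglyMeasurable_of_hasCompactSupport
      (HasCompactSupport.of_compactSpace _)).aestronglyMeasurable
  · exact .of_forall fun x s hs => hC (x, s) ⟨mem_univ _, hs⟩
  · refine .of_forall fun x s _ => DifferentiableAt.hasDerivAt ?_
    exact ((hf.comp (contDiff_prodMk_right (p x))).differentiable one_ne_zero) s

/-- Iterated differentiation under the integral sign for a smooth integrand on a compact space. -/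
theorem iteratedDeriv_integral_of_contDiff_of_compact {P X F : Type*}
    [NormedAddCommGroup P] [NormedSpace ℝ P] [NormedAddCommGroup F] [NormedSpace ℝ F]
    [TopologicalSpace X] [CompactSpace X] [SecondCountableTopology X]
    [MeasurableSpace X] [OpensMeasurableSpace X] (ν : Measure X) [IsFiniteMeasure ν]
    {p : X → P} (hp : Continuous p) (m : ℕ) {f : P → ℝ → F}
    (hf : ContDiff ℝ (⊤ : ℕ∞) (Function.uncurry f)) (t : ℝ) :
    iteratedDeriv m (fun t => ∫ x, f (p x) t ∂ν) t = ∫ x, iteratedDeriv m (f (p x)) t ∂ν := by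
  induction m generalizing f with
  | zero => simp
  | succ m ih =>
    have hderiv : deriv (fun t => ∫ x, f (p x) t ∂ν) = fun t => ∫ x, deriv (f (p x)) t ∂ν :=
      funext fun s => (hasDerivAt_integral_of_contDiff_of_compact ν hp
        (hf.of_le (by exact_mod_cast le_top)) s).deriv
    have hf' : ContDiff ℝ (⊤ : ℕ∞) (Function.uncurry fun y => deriv (f y)) := by
      simp_rw [Function.uncurry_def, ← fderiv_apply_one_eq_deriv]
      exact ContDiff.fderiv_apply (m := (⊤ : ℕ∞)) (f := fun y : P × ℝ => f y.1)
        (g := fun y => y.2) (k := fun _ => (1 : ℝ))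
        (hf.comp ((contDiff_fst.comp contDiff_fst).prodMk contDiff_snd))
        contDiff_snd contDiff_const (by simp)
    simp_rw [iteratedDeriv_succ', hderiv]
    exact ih hf'

theorem iteratedDeriv_cos_smul_add_sin_smul {E : Type*} [NormedAddCommGroup E] [NormedSpace ℝ E]
    (a b : E) (i : ℕ) :
    iteratedDeriv i (fun t : ℝ => cos t • a + sin t • b) =
      fun t => cos (t + i * (π / 2)) • a + sin (t + i * (π / 2)) • b := by
  induction i with
  | zero => simp
  | succ i ih =>
    rw [iteratedDeriv_succ, ih]
    funext t
    have h := (hasDerivAt_id t).add_const (i * (π / 2))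
    refine ((h.cos.smul_const a).add (h.sin.smul_const b)).deriv.trans ?_
    have e : t + ((i + 1 : ℕ) : ℝ) * (π / 2) = (t + i * (π / 2)) + π / 2 := by push_cast; ring
    rw [e, cos_add_pi_div_two, sin_add_pi_div_two]
    simp

theorem norm_cos_smul_add_sin_smul {E : Type*} [NormedAddCommGroup E] [InnerProductSpace ℝ E]
    {a b : E} (ha : ‖a‖ = 1) (hb : ‖b‖ = 1) (hab : inner ℝ a b = 0) (t : ℝ) :
    ‖cos t • a + sin t • b‖ = 1 := by
  have h : ‖cos t • a + sin t • b‖ ^ 2 = 1 := by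
    rw [norm_add_sq_real, inner_smul_left, inner_smul_right, hab, norm_smul, norm_smul, ha, hb]
    simp
  exact (pow_eq_one_iff_of_nonneg (norm_nonneg _) two_ne_zero).1 h

/-- Derivatives of a function of polynomial growth along the circle of radius `r`. -/
theorem exists_norm_iteratedDeriv_comp_circle_le {E F : Type*} [NormedAddCommGroup E]
    [InnerProductSpace ℝ E] [NormedAddCommGroup F] [NormedSpace ℝ F] {s : E → F} {k : ℕ}
    (hs : ContDiff ℝ (⊤ : ℕ∞) s)
    (hbd : ∀ i : ℕ, ∃ C : ℝ, ∀ x, ‖iteratedFDeriv ℝ i s x‖ ≤ C * (1 + ‖x‖) ^ k)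
    {m : ℕ} (hm : 1 ≤ m) :
    ∃ C : ℝ, 0 < C ∧ ∀ a b : E, ‖a‖ = 1 → ‖b‖ = 1 → inner ℝ a b = 0 → ∀ r : ℝ, 0 ≤ r → ∀ t : ℝ,
      ‖iteratedDeriv m (fun t : ℝ => s (r • (cos t • a + sin t • b))) t‖ ≤
        C * r * (1 + r) ^ (k + m - 1) := by
  choose c hc using hbd
  set B : ℝ := 1 + ∑ i ∈ Finset.range (m + 1), |c i| with hB
  have hB0 : 0 < B := by positivity
  have hcB (i : ℕ) (hi : i ≤ m) : c i ≤ B := by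
    have := Finset.single_le_sum (f := fun i => |c i|) (fun _ _ => abs_nonneg _)
      (Finset.mem_range.2 (Nat.lt_succ_of_le hi))
    linarith [le_abs_self (c i)]
  refine ⟨m.factorial * B, by positivity, fun a b ha hb hab r hr t => ?_⟩
  set u : ℝ → E := fun t => cos t • a + sin t • b with hu_def
  have hu : ContDiff ℝ (⊤ : ℕ∞) u := by fun_prop
  have hunorm (t : ℝ) : ‖u t‖ = 1 := norm_cos_smul_add_sin_smul ha hb hab t
  set g : E → F := fun x => s (r • x) - s 0 with hg_def
  have hsr : ContDiff ℝ (⊤ : ℕ∞) fun x => s (r • x) := hs.comp (contDiff_const_smul r)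
  have hg : ContDiff ℝ (⊤ : ℕ∞) g := hsr.sub contDiff_const
  have hrnorm : ‖r • u t‖ = r := by rw [norm_smul, hunorm, mul_one, norm_of_nonneg hr]
  have hr1 : 1 ≤ 1 + r := by linarith
  have hgbd (i : ℕ) (hi : i ≤ m) :
      ‖iteratedFDeriv ℝ i g (u t)‖ ≤ B * r * (1 + r) ^ (k + m - 1) := by
    rcases Nat.eq_zero_or_pos i with rfl | hi0
    · rw [norm_iteratedFDeriv_zero]
      have hmv := (convex_closedBall (0 : E) r).norm_image_sub_le_of_norm_fderiv_le (𝕜 := ℝ)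
        (f := s) (C := B * (1 + r) ^ k) (fun x _ => hs.differentiable (by simp) x)
        (fun x hx => ?_) (Metric.mem_closedBall_self hr)
        (show r • u t ∈ Metric.closedBall (0 : E) r by simp [hrnorm])
      · rw [sub_zero, hrnorm] at hmv
        calc _ ≤ B * (1 + r) ^ k * r := hmv
          _ = B * r * (1 + r) ^ k := by ring
          _ ≤ _ := by gcongr; omega
      · rw [← norm_iteratedFDeriv_one]
        have hx' : ‖x‖ ≤ r := by simpa using hx
        refine (hc 1 x).trans ?_
        gcongr
        exact hcB 1 hm
    · have e : iteratedFDeriv ℝ i g (u t) = r ^ i • iteratedFDeriv ℝ i s (r • u t) := by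
        rw [show g = (fun x => s (r • x)) - fun _ => s 0 from rfl, iteratedFDeriv_sub_apply
          (hsr.of_le (by exact_mod_cast le_top)).contDiffAt contDiffAt_const,
          iteratedFDeriv_const_of_ne hi0.ne', Pi.zero_apply, sub_zero,
          iteratedFDeriv_comp_const_smul r (hs.of_le (by exact_mod_cast le_top))]
      obtain ⟨j, rfl⟩ := Nat.exists_eq_add_of_le' hi0
      have hsb := hc (j + 1) (r • u t)
      rw [hrnorm] at hsb
      rw [e, norm_smul, norm_of_nonneg (by positivity)]
      calc r ^ (j + 1) * ‖iteratedFDeriv ℝ (j + 1) s (r • u t)‖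
          ≤ r ^ (j + 1) * (B * (1 + r) ^ k) := by
            gcongr
            refine hsb.trans ?_
            gcongr
            exact hcB _ hi
        _ = B * r * (r ^ j * (1 + r) ^ k) := by ring
        _ ≤ B * r * ((1 + r) ^ j * (1 + r) ^ k) := by gcongr; linarith
        _ = B * r * (1 + r) ^ (j + k) := by rw [pow_add]
        _ ≤ _ := by gcongr; omega
  have hubd (i : ℕ) : ‖iteratedFDeriv ℝ i u t‖ ≤ 1 ^ i := by
    rw [norm_iteratedFDeriv_eq_norm_iteratedDeriv, iteratedDeriv_cos_smul_add_sin_smul, one_pow]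
    exact (hunorm _).le
  have hcomp := norm_iteratedFDeriv_comp_le hg hu (n := m) (by exact_mod_cast le_top) t hgbd
    (fun i _ _ => hubd i)
  have e : (fun t : ℝ => s (r • (cos t • a + sin t • b))) = fun t => s 0 + (g ∘ u) t := by
    funext t; simp [hg_def, hu_def]
  rw [e, iteratedDeriv_const_add hm, ← norm_iteratedFDeriv_eq_norm_iteratedDeriv]
  simpa [mul_assoc] using hcomp

/-- The inclusion of `ℝ^d` as the hyperplane of `ℝ^(d+1)` with vanishing first coordinate. -/
noncomputable def consZeroCLM (d : ℕ) :
    EuclideanSpace ℝ (Fin d) →L[ℝ] EuclideanSpace ℝ (Fin (d + 1)) :=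
  LinearMap.toContinuousLinearMap
    { toFun := fun v => WithLp.toLp 2 (Fin.cons 0 fun j => v j)
      map_add' := fun v w => by ext j; cases j using Fin.cases <;> simp
      map_smul' := fun c v => by ext j; cases j using Fin.cases <;> simp }

@[simp] theorem consZeroCLM_zero {d : ℕ} (v : EuclideanSpace ℝ (Fin d)) :
    consZeroCLM d v 0 = 0 := rfl

@[simp] theorem consZeroCLM_succ {d : ℕ} (v : EuclideanSpace ℝ (Fin d)) (j : Fin d) :
    consZeroCLM d v j.succ = v j := rfl

theorem norm_consZeroCLM {d : ℕ} (v : EuclideanSpace ℝ (Fin d)) : ‖consZeroCLM d v‖ = ‖v‖ := by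
  simp [EuclideanSpace.norm_eq, Fin.sum_univ_succ]

theorem Dfun_eq_integral_circle (l' : ℕ) (ς : EuclideanSpace ℝ (Fin (l' + 2)) → ℂ) (r θ : ℝ) :
    Dfun l' ς r θ = ∫ ω : Metric.sphere (0 : EuclideanSpace ℝ (Fin (l' + 1))) 1,
      ς (r • (cos θ • EuclideanSpace.single 0 1 + sin θ • consZeroCLM (l' + 1) ω))
      ∂((volume : Measure (EuclideanSpace ℝ (Fin (l' + 1)))).toSphere) := by
  unfold Dfun
  congr! 3 with ω
  ext j
  cases j using Fin.cases <;> simp [mul_assoc]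

/-- bounds on θ-derivatives of `D_r(θ)`. Here `l = l' + 2`. -/
theorem stmt11 (l' n : ℕ) (hn : l' + 2 ≤ n)
    (ς : EuclideanSpace ℝ (Fin (l' + 2)) → ℂ) (hς : ContDiff ℝ (⊤ : ℕ∞) ς)
    (hbd : ∀ μ : ℕ, ∃ C : ℝ, ∀ lam : EuclideanSpace ℝ (Fin (l' + 2)),
      ‖iteratedFDeriv ℝ μ ς lam‖ ≤ C * (1 + ‖lam‖) ^ (n - (l' + 2))) :
    ∀ m : ℕ, 1 ≤ m → ∃ C : ℝ, 0 < C ∧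
      ∀ r : ℝ, 0 ≤ r → ∀ θ : ℝ, θ ∈ Icc 0 π →
        ‖iteratedDeriv m (fun θ' : ℝ => Dfun l' ς r θ') θ‖
          ≤ C * r * (1 + r) ^ (n - (l' + 2) + m - 1) := by
  intro m hm
  obtain ⟨C, hC0, hC⟩ := exists_norm_iteratedDeriv_comp_circle_le hς hbd hm
  set ν := (volume : Measure (EuclideanSpace ℝ (Fin (l' + 1)))).toSphere
  refine ⟨C * (ν.real univ + 1), by positivity, fun r hr θ _ => ?_⟩
  have hf : ContDiff ℝ (⊤ : ℕ∞) (Function.uncurry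
      fun (v : EuclideanSpace ℝ (Fin (l' + 1))) (t : ℝ) =>
        ς (r • (cos t • EuclideanSpace.single 0 1 + sin t • consZeroCLM (l' + 1) v))) := by
    refine hς.comp ?_
    fun_prop
  simp_rw [Dfun_eq_integral_circle]
  rw [iteratedDeriv_integral_of_contDiff_of_compact ν continuous_subtype_val m hf θ]
  refine (norm_integral_le_of_norm_le_const (C := C * r * (1 + r) ^ (n - (l' + 2) + m - 1))
    (.of_forall fun ω => hC _ _ (by simp) ?_ ?_ r hr θ)).trans ?_
  · rw [norm_consZeroCLM]
    exact mem_sphere_zero_iff_norm.1 ω.2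
  · simp [EuclideanSpace.inner_single_left]
  · have h : 0 ≤ C * r * (1 + r) ^ (n - (l' + 2) + m - 1) := by positivity
    linarith
end

section
/- Let l ≥ 2, n ≥ l and a ≥ 0 be integers and let ς : ℝ^l → ℂ be smooth such that for every multi-index μ there is a constant C_μ with |∂^μ ς(λ)| ≤ C_μ (1+|λ|)^{n−l} for all λ ∈ ℝ^l, and such that ∂^μ ς(0) = 0 for every multi-index μ with |μ| < a. For r ≥ 0 and θ ∈ [0,π] define D_r(θ) = ∫_{S^{l−2}} ς( r (cos θ, (sin θ) ω) ) dω, where the integral is over the unit sphere S^{l−2} ⊂ ℝ^{l−1} with its surface measure (for l = 2, S^0 = {±1} with counting measure). Then for every integer m ≥ 0 there is a constant C_{l,m} > 0 such that for all 0 ≤ r ≤ 1 and θ ∈ [0,π], | d^m/dθ^m D_r(θ) | ≤ C_{l,m} r^{a}. -/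
open MeasureTheory Set Real

/-- A smooth function whose derivatives of order `< a` vanish at the origin has its `i`-th
derivative of size `O(‖x‖ ^ (a - i))` on bounded balls. -/
theorem exists_norm_iteratedFDeriv_le_pow {E F : Type*} [NormedAddCommGroup E] [NormedSpace ℝ E]
    [ProperSpace E] [NormedAddCommGroup F] [NormedSpace ℝ F] {f : E → F}
    (hf : ContDiff ℝ (⊤ : ℕ∞) f) {a : ℕ} (h0 : ∀ i < a, iteratedFDeriv ℝ i f 0 = 0)
    (R : ℝ) (i : ℕ) :
    ∃ C : ℝ, 0 ≤ C ∧ ∀ x : E, ‖x‖ ≤ R → ‖iteratedFDeriv ℝ i f x‖ ≤ C * ‖x‖ ^ (a - i) := by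
  induction hk : a - i generalizing i with
  | zero =>
    obtain ⟨C, hC⟩ := (isCompact_closedBall (0 : E) R).exists_bound_of_continuousOn
      (hf.continuous_iteratedFDeriv (m := i) (mod_cast le_top)).continuousOn
    refine ⟨max C 0, le_max_right _ _, fun x hx => ?_⟩
    simpa using Or.inl (hC x (by simpa using hx))
  | succ k ih =>
    obtain ⟨C, hC0, hC⟩ := ih (i + 1) (by omega)
    refine ⟨C, hC0, fun x hx => ?_⟩
    have hdiff : Differentiable ℝ (iteratedFDeriv ℝ i f) :=
      hf.differentiable_iteratedFDeriv (mod_cast WithTop.coe_lt_top i)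
    have hmv := (convex_closedBall (0 : E) ‖x‖).norm_image_sub_le_of_norm_fderiv_le (𝕜 := ℝ)
      (f := iteratedFDeriv ℝ i f) (C := C * ‖x‖ ^ k) (x := 0) (y := x)
      (fun y _ => hdiff y)
      (fun y hy => by
        have hy' : ‖y‖ ≤ ‖x‖ := by simpa using hy
        rw [norm_fderiv_iteratedFDeriv]
        exact (hC y (hy'.trans hx)).trans (by gcongr))
      (by simp) (by simp)
    rw [h0 i (by omega), sub_zero, sub_zero] at hmv
    exact hmv.trans_eq (by ring)

/-- The derivatives of the dilates `y ↦ f (r • y)` are `O(r ^ a)` on bounded balls, when the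
derivatives of `f` of order `< a` vanish at the origin. -/
theorem exists_norm_iteratedFDeriv_comp_smul_le {E F : Type*} [NormedAddCommGroup E]
    [NormedSpace ℝ E] [ProperSpace E] [NormedAddCommGroup F] [NormedSpace ℝ F] {f : E → F}
    (hf : ContDiff ℝ (⊤ : ℕ∞) f) {a : ℕ} (h0 : ∀ i < a, iteratedFDeriv ℝ i f 0 = 0)
    {R : ℝ} (hR : 0 ≤ R) (i : ℕ) :
    ∃ C : ℝ, 0 ≤ C ∧ ∀ r : ℝ, 0 ≤ r → r ≤ 1 → ∀ y : E, ‖y‖ ≤ R →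
      ‖iteratedFDeriv ℝ i (fun z => f (r • z)) y‖ ≤ C * r ^ a := by
  obtain ⟨C, hC0, hC⟩ := exists_norm_iteratedFDeriv_le_pow hf h0 R i
  refine ⟨C * R ^ (a - i), by positivity, fun r hr0 hr1 y hy => ?_⟩
  have hnorm : ‖r • y‖ ≤ r * R := by
    rw [norm_smul, Real.norm_of_nonneg hr0]
    gcongr
  have hcomp := (r • ContinuousLinearMap.id ℝ E).iteratedFDeriv_comp_right hf y
    (i := i) (mod_cast le_top)
  have hid : ‖r • ContinuousLinearMap.id ℝ E‖ ≤ r := by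
    rw [norm_smul, Real.norm_of_nonneg hr0]
    exact mul_le_of_le_one_right hr0 ContinuousLinearMap.norm_id_le
  have hpow : r ^ (a - i) * r ^ i ≤ r ^ a := by
    rw [← pow_add]
    exact pow_le_pow_of_le_one hr0 hr1 (by omega)
  calc ‖iteratedFDeriv ℝ i (fun z => f (r • z)) y‖
      = ‖(iteratedFDeriv ℝ i f (r • y)).compContinuousLinearMap
          fun _ => r • ContinuousLinearMap.id ℝ E‖ := congrArg norm hcomp
    _ ≤ ‖iteratedFDeriv ℝ i f (r • y)‖ * ∏ _j : Fin i, ‖r • ContinuousLinearMap.id ℝ E‖ :=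
      ContinuousMultilinearMap.norm_compContinuousLinearMap_le _ _
    _ ≤ (C * (r * R) ^ (a - i)) * r ^ i := by
      rw [Finset.prod_const, Finset.card_univ, Fintype.card_fin]
      gcongr
      exact (hC _ (hnorm.trans (mul_le_of_le_one_left hR hr1))).trans (by gcongr)
    _ = C * R ^ (a - i) * (r ^ (a - i) * r ^ i) := by ring
    _ ≤ C * R ^ (a - i) * r ^ a := by gcongr

/-- The iterated derivatives of `θ ↦ cos θ • u + sin θ • v` are bounded by `‖u‖ + ‖v‖`. -/
theorem norm_iteratedDeriv_cos_smul_add_sin_smul_le {E : Type*} [NormedAddCommGroup E]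
    [NormedSpace ℝ E] (u v : E) (i : ℕ) (θ : ℝ) :
    ‖iteratedDeriv i (fun t : ℝ => Real.cos t • u + Real.sin t • v) θ‖ ≤ ‖u‖ + ‖v‖ := by
  have hc : ContDiffAt ℝ i Real.cos θ := Real.contDiff_cos.contDiffAt
  have hs : ContDiffAt ℝ i Real.sin θ := Real.contDiff_sin.contDiffAt
  rw [iteratedDeriv_fun_add (hc.smul_const u) (hs.smul_const v),
    iteratedDeriv_smul_const hc, iteratedDeriv_smul_const hs]
  refine (norm_add_le _ _).trans ?_
  rw [norm_smul, norm_smul]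
  exact add_le_add
    (mul_le_of_le_one_left (norm_nonneg _) (Real.abs_iteratedDeriv_cos_le_one i θ))
    (mul_le_of_le_one_left (norm_nonneg _) (Real.abs_iteratedDeriv_sin_le_one i θ))

/-- Iterated derivatives in the last variable of a jointly smooth function are jointly smooth. -/
theorem ContDiff.iteratedDeriv_snd {V F : Type*} [NormedAddCommGroup V] [NormedSpace ℝ V]
    [NormedAddCommGroup F] [NormedSpace ℝ F] {H : V × ℝ → F} (hH : ContDiff ℝ (⊤ : ℕ∞) H)
    (m : ℕ) : ContDiff ℝ (⊤ : ℕ∞) fun p : V × ℝ => iteratedDeriv m (fun t => H (p.1, t)) p.2 := by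
  induction m with
  | zero => simpa using hH
  | succ m ih =>
    simp_rw [iteratedDeriv_succ]
    set K := fun p : V × ℝ => iteratedDeriv m (fun t => H (p.1, t)) p.2
    have hK : (fun p : V × ℝ => deriv (iteratedDeriv m fun t => H (p.1, t)) p.2) =
        fun p => fderiv ℝ K p (0, 1) := by
      funext p
      have h := ((ih.differentiable (by simp)) p).hasFDerivAt.comp_hasDerivAt p.2
        (f := fun t => (p.1, t)) ((hasDerivAt_const p.2 p.1).prodMk (hasDerivAt_id p.2))
      exact h.deriv
    rw [hK]
    exact (ih.fderiv_right (m := (⊤ : ℕ∞)) (by simp)).clm_apply contDiff_const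

/-- Iterated differentiation under the integral sign over a finite measure, for integrands all of
whose derivatives are uniformly bounded. -/
theorem iteratedDeriv_integral_of_bounded {Ω F : Type*} [MeasurableSpace Ω]
    [NormedAddCommGroup F] [NormedSpace ℝ F] {μ : Measure Ω} [IsFiniteMeasure μ]
    {G : Ω → ℝ → F} (hG : ∀ ω, ContDiff ℝ (⊤ : ℕ∞) (G ω))
    (hmeas : ∀ m θ, AEStronglyMeasurable (fun ω => iteratedDeriv m (G ω) θ) μ)
    (hbdd : ∀ m, ∃ B : ℝ, ∀ ω θ, ‖iteratedDeriv m (G ω) θ‖ ≤ B) (m : ℕ) :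
    iteratedDeriv m (fun θ => ∫ ω, G ω θ ∂μ) = fun θ => ∫ ω, iteratedDeriv m (G ω) θ ∂μ := by
  induction m with
  | zero => simp
  | succ m ih =>
    rw [iteratedDeriv_succ, ih]
    funext θ
    obtain ⟨B, hB⟩ := hbdd m
    obtain ⟨B', hB'⟩ := hbdd (m + 1)
    refine (hasDerivAt_integral_of_dominated_loc_of_deriv_le (bound := fun _ => B')
      (F' := fun t ω => iteratedDeriv (m + 1) (G ω) t)
      Filter.univ_mem (Filter.Eventually.of_forall (hmeas m))
      (Integrable.of_bound (hmeas m θ) B (Filter.Eventually.of_forall fun ω => hB ω θ))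
      (hmeas (m + 1) θ) (Filter.Eventually.of_forall fun ω t _ => hB' ω t)
      (integrable_const _) (Filter.Eventually.of_forall fun ω t _ => ?_)).2.deriv
    rw [iteratedDeriv_succ]
    exact ((hG ω).differentiable_iteratedDeriv m (mod_cast WithTop.coe_lt_top m) t).hasDerivAt

/-- The polar axis of `ℝ^(l' + 2)`. -/
noncomputable def polarAxis (l' : ℕ) : EuclideanSpace ℝ (Fin (l' + 2)) :=
  EuclideanSpace.single 0 1

/-- The inclusion of `ℝ^(l' + 1)` in `ℝ^(l' + 2)` as the hyperplane orthogonal to the polar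
axis. -/
noncomputable def equatorialInclusion (l' : ℕ) :
    EuclideanSpace ℝ (Fin (l' + 1)) →ₗᵢ[ℝ] EuclideanSpace ℝ (Fin (l' + 2)) where
  toFun v := WithLp.toLp 2 (Fin.cons 0 fun j => v j)
  map_add' v w := by
    ext j
    refine Fin.cases ?_ (fun j => ?_) j <;> simp
  map_smul' c v := by
    ext j
    refine Fin.cases ?_ (fun j => ?_) j <;> simp
  norm_map' v := by
    simp [EuclideanSpace.norm_eq, Fin.sum_univ_succ]

theorem polar_coordinates_eq (l' : ℕ) (r θ : ℝ) (v : EuclideanSpace ℝ (Fin (l' + 1))) :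
    (EuclideanSpace.equiv (Fin (l' + 2)) ℝ).symm
        (Fin.cons (r * Real.cos θ) fun j : Fin (l' + 1) => r * Real.sin θ * v j) =
      r • (Real.cos θ • polarAxis l' + Real.sin θ • equatorialInclusion l' v) := by
  ext j
  refine Fin.cases ?_ (fun j => ?_) j <;> simp [polarAxis, equatorialInclusion, mul_assoc]

/-- small-`r` bounds on θ-derivatives of `D_r(θ)` when all derivatives of `ς`
of order `< a` vanish at the origin. Here `l = l' + 2`. -/
theorem stmt12 (l' n a : ℕ) (hn : l' + 2 ≤ n)
    (ς : EuclideanSpace ℝ (Fin (l' + 2)) → ℂ) (hς : ContDiff ℝ (⊤ : ℕ∞) ς)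
    (hbd : ∀ μ : ℕ, ∃ C : ℝ, ∀ lam : EuclideanSpace ℝ (Fin (l' + 2)),
      ‖iteratedFDeriv ℝ μ ς lam‖ ≤ C * (1 + ‖lam‖) ^ (n - (l' + 2)))
    (h0 : ∀ μ : ℕ, μ < a → iteratedFDeriv ℝ μ ς 0 = 0) :
    ∀ m : ℕ, ∃ C : ℝ, 0 < C ∧
      ∀ r : ℝ, 0 ≤ r → r ≤ 1 → ∀ θ : ℝ, θ ∈ Icc 0 π →
        ‖iteratedDeriv m (fun θ' : ℝ => Dfun l' ς r θ') θ‖ ≤ C * r ^ a := by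
  intro m
  have hcurve (ω : Metric.sphere (0 : EuclideanSpace ℝ (Fin (l' + 1))) 1) (i : ℕ) (θ : ℝ) :
      ‖iteratedDeriv i (fun t : ℝ => Real.cos t • polarAxis l' +
        Real.sin t • equatorialInclusion l' ω) θ‖ ≤ 2 := by
    refine (norm_iteratedDeriv_cos_smul_add_sin_smul_le _ _ i θ).trans_eq ?_
    rw [LinearIsometry.norm_map, norm_eq_of_mem_sphere, polarAxis, PiLp.norm_single]
    norm_num
  have hkey : ∀ m : ℕ, ∃ C : ℝ, 0 ≤ C ∧ ∀ r : ℝ, 0 ≤ r → r ≤ 1 →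
      ∀ (ω : Metric.sphere (0 : EuclideanSpace ℝ (Fin (l' + 1))) 1) (θ : ℝ),
      ‖iteratedDeriv m (fun t : ℝ => ς (r • (Real.cos t • polarAxis l' +
        Real.sin t • equatorialInclusion l' ω))) θ‖ ≤ C * r ^ a := by
    intro m
    choose C hC0 hC using exists_norm_iteratedFDeriv_comp_smul_le hς h0 zero_le_two
    refine ⟨m.factorial * (∑ i ∈ Finset.range (m + 1), C i) * 2 ^ m,
      by have := Finset.sum_nonneg fun i (_ : i ∈ Finset.range (m + 1)) => hC0 i
         positivity,
      fun r hr0 hr1 ω θ => ?_⟩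
    rw [← norm_iteratedFDeriv_eq_norm_iteratedDeriv]
    refine (norm_iteratedFDeriv_comp_le (N := (⊤ : ℕ∞)) (g := fun z => ς (r • z))
      (f := fun t : ℝ => Real.cos t • polarAxis l' + Real.sin t • equatorialInclusion l' ω)
      (C := (∑ i ∈ Finset.range (m + 1), C i) * r ^ a) (D := 2)
      (by fun_prop) (by fun_prop) (mod_cast le_top) θ (fun i hi => ?_)
      (fun i hi _ => ?_)).trans_eq (by ring)
    · refine (hC i r hr0 hr1 _ (by simpa using hcurve ω 0 θ)).trans ?_
      gcongr
      exact Finset.single_le_sum (fun j _ => hC0 j) (Finset.mem_range.2 (by omega))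
    · rw [norm_iteratedFDeriv_eq_norm_iteratedDeriv]
      exact (hcurve ω i θ).trans (le_self_pow₀ one_le_two (by omega))
  obtain ⟨C, hC0, hC⟩ := hkey m
  set σ := (volume : Measure (EuclideanSpace ℝ (Fin (l' + 1)))).toSphere
  refine ⟨C * σ.real univ + 1, by positivity, fun r hr0 hr1 θ _ => ?_⟩
  have hsmooth : ContDiff ℝ (⊤ : ℕ∞) fun p : EuclideanSpace ℝ (Fin (l' + 1)) × ℝ =>
      ς (r • (Real.cos p.2 • polarAxis l' + Real.sin p.2 • equatorialInclusion l' p.1)) := by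
    have := (equatorialInclusion l').contDiff (n := (⊤ : ℕ∞))
    fun_prop
  simp_rw [Dfun, polar_coordinates_eq]
  rw [iteratedDeriv_integral_of_bounded]
  · calc _ ≤ C * r ^ a * σ.real univ :=
          norm_integral_le_of_norm_le_const (Filter.Eventually.of_forall fun ω => hC r hr0 hr1 ω θ)
      _ = C * σ.real univ * r ^ a := by ring
      _ ≤ _ := by
        gcongr
        exact le_add_of_nonneg_right zero_le_one
  · intro ω
    fun_prop
  · intro m θ
    have := (hsmooth.iteratedDeriv_snd m).continuous
    exact (this.comp (continuous_subtype_val.prodMk continuous_const)).aestronglyMeasurable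
  · intro m
    obtain ⟨C, -, hC⟩ := hkey m
    exact ⟨C * r ^ a, hC r hr0 hr1⟩
end

section
/- Let l ≥ 2, n ≥ l and a ≥ 0 be integers and let ς : ℝ^l → ℂ be smooth such that for every multi-index μ there is a constant C_μ with |∂^μ ς(λ)| ≤ C_μ (1+|λ|)^{n−l} for all λ ∈ ℝ^l. For r ≥ 0 and θ ∈ [0,π] define D_r(θ) = ∫_{S^{l−2}} ς( r (cos θ, (sin θ) ω) ) dω, where the integral is over the unit sphere S^{l−2} ⊂ ℝ^{l−1} with its surface measure (for l = 2, S^0 = {±1} with counting measure). Then for all integers m ≥ 0, k ≥ 0 and s ≥ 0 there is a constant C_{l,m,k,s} > 0 such that for all r > 0 and θ ∈ [0,π], | d^m/dr^m ( r^{s} ∂_θ^{k} D_r(θ) ) | ≤ C_{l,m,k,s} (1+r)^{n−l+k+s}. If moreover ∂^μ ς(0) = 0 for every multi-index μ with |μ| < a, then there is a constant C'_{m,k,s} > 0 such that | d^m/dr^m ( r^{s} ∂_θ^{k} D_r(θ) ) | ≤ C'_{m,k,s} r^{s+a−m} for all 0 < r ≤ 1 and θ ∈ [0,π]. -/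
open MeasureTheory Set Real

open scoped ContDiff RealInnerProductSpace

section SymbolFamily

variable {P Q E F G H : Type*}
  [NormedAddCommGroup P] [NormedSpace ℝ P] [NormedAddCommGroup Q] [NormedSpace ℝ Q]
  [NormedAddCommGroup E] [InnerProductSpace ℝ E]
  [NormedAddCommGroup F] [NormedSpace ℝ F] [NormedAddCommGroup G] [NormedSpace ℝ G]
  [NormedAddCommGroup H] [NormedSpace ℝ H]

theorem ContinuousLinearMap.norm_iteratedFDeriv_le_norm_mul (A : E →L[ℝ] G) (j : ℕ) (x : E) :
    ‖iteratedFDeriv ℝ j A x‖ ≤ ‖A‖ * (1 + ‖x‖) := by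
  have hA := norm_nonneg A
  have hx := norm_nonneg x
  rcases j with _ | _ | j
  · rw [norm_iteratedFDeriv_zero]
    nlinarith [A.le_opNorm x]
  · rw [← norm_iteratedFDeriv_fderiv, norm_iteratedFDeriv_zero, A.fderiv]
    nlinarith
  · have : fderiv ℝ (A : E → G) = fun _ => A := by ext1 y; exact A.fderiv
    rw [← norm_iteratedFDeriv_fderiv, this, iteratedFDeriv_succ_const]
    simp only [Pi.zero_apply, norm_zero]
    positivity

/-- Smooth families `f p`, `p : P`, of functions on `E` all of whose derivatives are
`O((1 + ‖x‖) ^ N)` uniformly for `p ∈ K`, and which vanish to order `a` at the origin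
for `p ∈ K`. -/
structure IsSymbolFamily (K : Set P) (N a : ℕ) (f : P → E → F) : Prop where
  contDiff : ContDiff ℝ ∞ (Function.uncurry f)
  bound : ∀ μ : ℕ, ∃ C : ℝ, ∀ p ∈ K, ∀ x, ‖iteratedFDeriv ℝ μ (f p) x‖ ≤ C * (1 + ‖x‖) ^ N
  vanish : ∀ μ < a, ∀ p ∈ K, iteratedFDeriv ℝ μ (f p) 0 = 0

namespace IsSymbolFamily

variable {K : Set P} {N a : ℕ} {f : P → E → F}

theorem contDiff_apply (hf : IsSymbolFamily K N a f) (p : P) : ContDiff ℝ ∞ (f p) :=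
  hf.contDiff.comp (contDiff_const.prodMk contDiff_id)

theorem norm_le (hf : IsSymbolFamily K N a f) :
    ∃ C : ℝ, ∀ p ∈ K, ∀ x, ‖f p x‖ ≤ C * (1 + ‖x‖) ^ N := by
  simpa only [norm_iteratedFDeriv_zero] using hf.bound 0

theorem apply_zero (hf : IsSymbolFamily K N a f) (ha : 0 < a) {p : P} (hp : p ∈ K) :
    f p 0 = 0 := by
  rw [← norm_eq_zero, ← norm_iteratedFDeriv_zero (𝕜 := ℝ) (f := f p), hf.vanish 0 ha p hp,
    norm_zero]

theorem mono_order (hf : IsSymbolFamily K N a f) {b : ℕ} (hb : b ≤ a) :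
    IsSymbolFamily K N b f :=
  ⟨hf.contDiff, hf.bound, fun μ hμ => hf.vanish μ (hμ.trans_le hb)⟩

theorem comp_param (hf : IsSymbolFamily K N a f) {L : Set Q} {g : Q → P} (hg : ContDiff ℝ ∞ g)
    (hL : MapsTo g L K) : IsSymbolFamily L N a (fun q => f (g q)) where
  contDiff := hf.contDiff.comp ((hg.comp contDiff_fst).prodMk contDiff_snd)
  bound μ := (hf.bound μ).imp fun _ hC _ hq => hC _ (hL hq)
  vanish μ hμ _ hq := hf.vanish μ hμ _ (hL hq)

protected theorem fderiv (hf : IsSymbolFamily K N a f) :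
    IsSymbolFamily K N (a - 1) (fun p x => fderiv ℝ (f p) x) where
  contDiff := by
    have : ContDiff ℝ ∞ (Function.uncurry fun (q : P × E) (x : E) => f q.1 x) :=
      hf.contDiff.comp ((contDiff_fst.comp contDiff_fst).prodMk contDiff_snd)
    exact this.fderiv contDiff_snd le_rfl
  bound μ := by
    simpa only [norm_iteratedFDeriv_fderiv] using hf.bound (μ + 1)
  vanish μ hμ p hp := by
    rw [← norm_eq_zero, norm_iteratedFDeriv_fderiv, hf.vanish (μ + 1) (by omega) p hp, norm_zero]

theorem bilin_linear (hf : IsSymbolFamily K N a f) (B : F →L[ℝ] G →L[ℝ] H)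
    {A : P → E →L[ℝ] G} (hA : ContDiff ℝ ∞ A) {M : ℝ} (hM : ∀ p ∈ K, ‖A p‖ ≤ M) :
    IsSymbolFamily K (N + 1) (a + 1) (fun p x => B (f p x) (A p x)) where
  contDiff :=
    (B.contDiff.comp hf.contDiff).clm_apply ((hA.comp contDiff_fst).clm_apply contDiff_snd)
  bound μ := by
    choose C hC using hf.bound
    refine ⟨‖B‖ * ∑ i ∈ Finset.range (μ + 1), (μ.choose i : ℝ) * (C i * M), fun p hp x => ?_⟩
    refine (B.norm_iteratedFDeriv_le_of_bilinear (hf.contDiff_apply p) (A p).contDiff x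
      (mod_cast le_top)).trans ?_
    rw [mul_assoc, Finset.sum_mul]
    refine mul_le_mul_of_nonneg_left (Finset.sum_le_sum fun i _ => ?_) (norm_nonneg B)
    have hAi : ‖iteratedFDeriv ℝ (μ - i) (A p) x‖ ≤ M * (1 + ‖x‖) :=
      ((A p).norm_iteratedFDeriv_le_norm_mul _ x).trans
        (mul_le_mul_of_nonneg_right (hM p hp) (by positivity))
    calc _ ≤ (μ.choose i : ℝ) * ((C i * (1 + ‖x‖) ^ N) * (M * (1 + ‖x‖))) := by
          rw [mul_assoc]
          exact mul_le_mul_of_nonneg_left (mul_le_mul (hC i p hp x) hAi (norm_nonneg _)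
            ((norm_nonneg _).trans (hC i p hp x))) (by positivity)
      _ = _ := by ring
  vanish μ hμ p hp := by
    rw [← norm_le_zero_iff]
    refine (B.norm_iteratedFDeriv_le_of_bilinear (hf.contDiff_apply p) (A p).contDiff 0
      (mod_cast le_top)).trans ?_
    rw [Finset.sum_eq_zero, mul_zero]
    intro i hi
    rw [Finset.mem_range] at hi
    rcases lt_or_ge i a with h | h
    · simp [hf.vanish i h p hp]
    · obtain rfl : i = μ := by omega
      rw [Nat.sub_self, norm_iteratedFDeriv_zero]
      simp

theorem clm_comp (hf : IsSymbolFamily K N a f) {A : P → F →L[ℝ] H}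
    (hA : ContDiff ℝ ∞ A) {M : ℝ} (hM : ∀ p ∈ K, ‖A p‖ ≤ M) :
    IsSymbolFamily K N a (fun p x => A p (f p x)) where
  contDiff := (hA.comp contDiff_fst).clm_apply hf.contDiff
  bound μ := by
    obtain ⟨C, hC⟩ := hf.bound μ
    refine ⟨M * C, fun p hp x => ?_⟩
    refine ((A p).norm_iteratedFDeriv_comp_left (hf.contDiff_apply p).contDiffAt
      (mod_cast le_top)).trans ?_
    rw [mul_assoc]
    exact mul_le_mul (hM p hp) (hC p hp x) (norm_nonneg _) ((norm_nonneg _).trans (hM p hp))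
  vanish μ hμ p hp := by
    rw [← norm_le_zero_iff]
    refine ((A p).norm_iteratedFDeriv_comp_left (hf.contDiff_apply p).contDiffAt
      (mod_cast le_top)).trans ?_
    simp [hf.vanish μ hμ p hp]

end IsSymbolFamily

/-- The derivative of `f u` along the infinitesimal rotation in the plane spanned by `e`, `u`. -/
noncomputable def rotDeriv (e : E) (f : E → E → F) (u x : E) : F :=
  fderiv ℝ (f u) x (⟪e, x⟫ • u - ⟪u, x⟫ • e)

/-- Multiplication by the linear function `⟪v, ·⟫`, where the parameter is `(u, v)`. -/
noncomputable def mulInner (f : E × E → E → F) (p : E × E) (x : E) : F :=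
  ⟪p.2, x⟫ • f p x

/-- Directional derivative in the direction `v`, where the parameter is `(u, v)`. -/
noncomputable def dirDeriv (f : E × E → E → F) (p : E × E) (x : E) : F :=
  fderiv ℝ (f p) x p.2

namespace IsSymbolFamily

variable {N a : ℕ}

protected theorem rotDeriv {e : E} {K : Set E} (hK : ∀ u ∈ K, ‖u‖ ≤ 1) {f : E → E → F}
    (hf : IsSymbolFamily K N a f) : IsSymbolFamily K (N + 1) a (rotDeriv e f) := by
  have hA : ContDiff ℝ ∞ fun u : E =>
      (innerSL ℝ e).smulRight u - (innerSL ℝ u).smulRight e :=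
    (contDiff_const.smulRight contDiff_id).sub
      ((innerSL ℝ).contDiff.smulRight contDiff_const)
  have hM : ∀ u ∈ K, ‖(innerSL ℝ e).smulRight u - (innerSL ℝ u).smulRight e‖ ≤
      ‖e‖ * 1 + 1 * ‖e‖ := fun u hu => by
    refine (norm_sub_le _ _).trans ?_
    rw [ContinuousLinearMap.norm_smulRight_apply, ContinuousLinearMap.norm_smulRight_apply,
      innerSL_apply_norm, innerSL_apply_norm]
    gcongr <;> exact hK u hu
  have := (hf.fderiv.bilin_linear (ContinuousLinearMap.id ℝ (E →L[ℝ] F)) hA hM).mono_order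
    (b := a) (by omega)
  exact this

protected theorem mulInner {K : Set (E × E)} (hK : ∀ p ∈ K, ‖p.2‖ ≤ 1) {f : E × E → E → F}
    (hf : IsSymbolFamily K N a f) : IsSymbolFamily K (N + 1) (a + 1) (mulInner f) := by
  have hA : ContDiff ℝ ∞ fun p : E × E => innerSL ℝ p.2 := (innerSL ℝ).contDiff.comp contDiff_snd
  exact hf.bilin_linear (ContinuousLinearMap.lsmul ℝ ℝ).flip hA (M := 1)
    fun p hp => by rw [innerSL_apply_norm]; exact hK p hp

protected theorem dirDeriv {K : Set (E × E)} (hK : ∀ p ∈ K, ‖p.2‖ ≤ 1) {f : E × E → E → F}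
    (hf : IsSymbolFamily K N a f) : IsSymbolFamily K N (a - 1) (dirDeriv f) := by
  have hA : ContDiff ℝ ∞ fun p : E × E => ContinuousLinearMap.apply ℝ F p.2 := by fun_prop
  refine hf.fderiv.clm_comp hA (M := 1) fun p hp => ?_
  refine ContinuousLinearMap.opNorm_le_bound _ zero_le_one fun T => ?_
  rw [ContinuousLinearMap.apply_apply, one_mul]
  exact T.unit_le_opNorm _ (hK p hp)

variable {X : Type*} [MeasurableSpace X] [TopologicalSpace X] [OpensMeasurableSpace X]
  [SecondCountableTopology X] {ν : Measure X} [IsFiniteMeasure ν]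
  {K : Set P} {f : P → E → F}

theorem hasDerivAt_integral (hf : IsSymbolFamily K N a f) {p : X → P} (hp : Continuous p)
    (hpK : ∀ x, p x ∈ K) {c c' : ℝ → X → E} (hc : ∀ t, Continuous (c t))
    (hc' : ∀ t, Continuous (c' t)) (hcd : ∀ t x, HasDerivAt (c · x) (c' t x) t) {t₀ R : ℝ}
    (hR : ∀ t ∈ Metric.ball t₀ 1, ∀ x, ‖c t x‖ ≤ R ∧ ‖c' t x‖ ≤ R) :
    HasDerivAt (fun t => ∫ x, f (p x) (c t x) ∂ν)
      (∫ x, fderiv ℝ (f (p x)) (c t₀ x) (c' t₀ x) ∂ν) t₀ := by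
  obtain ⟨C₀, hC₀⟩ := hf.norm_le
  obtain ⟨C₁, hC₁⟩ := hf.fderiv.norm_le
  have hF (t : ℝ) : Continuous fun x => f (p x) (c t x) :=
    hf.contDiff.continuous.comp (hp.prodMk (hc t))
  have hF' (t : ℝ) : Continuous fun x => fderiv ℝ (f (p x)) (c t x) (c' t x) :=
    (hf.fderiv.contDiff.continuous.comp (hp.prodMk (hc t))).clm_apply (hc' t)
  have key : ∀ {C y : ℝ} {n : ℝ}, 0 ≤ n → n ≤ C * (1 + y) ^ N → 0 ≤ y → y ≤ R →
      n ≤ |C| * (1 + R) ^ N := fun {C y n} hn h hy hyR => by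
    refine h.trans ?_
    gcongr
    exact le_abs_self C
  refine (hasDerivAt_integral_of_dominated_loc_of_deriv_le
    (F := fun t x => f (p x) (c t x)) (F' := fun t x => fderiv ℝ (f (p x)) (c t x) (c' t x))
    (bound := fun _ => |C₁| * (1 + R) ^ N * R)
    (Metric.ball_mem_nhds t₀ one_pos) (.of_forall fun t => (hF t).aestronglyMeasurable)
    ?_ (hF' t₀).aestronglyMeasurable (.of_forall fun x t ht => ?_) (integrable_const _)
    (.of_forall fun x t _ => ?_)).2
  · refine .of_bound (hF t₀).aestronglyMeasurable (|C₀| * (1 + R) ^ N) (.of_forall fun x => ?_)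
    exact key (norm_nonneg _) (hC₀ _ (hpK x) _) (norm_nonneg _)
      (hR t₀ (Metric.mem_ball_self one_pos) x).1
  · refine (ContinuousLinearMap.le_opNorm _ _).trans ?_
    have h := hR t ht x
    exact mul_le_mul (key (norm_nonneg _) (hC₁ _ (hpK x) _) (norm_nonneg _) h.1) h.2
      (norm_nonneg _) (by have := (norm_nonneg _).trans h.1; positivity)
  · have hd : DifferentiableAt ℝ (f (p x)) (c t x) :=
      (hf.contDiff_apply (p x)).contDiffAt.differentiableAt (by simp)
    exact hd.hasFDerivAt.comp_hasDerivAt t (hcd t x)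

variable {e : E} {K : Set E}

theorem iterate_rotDeriv (hK : ∀ u ∈ K, ‖u‖ ≤ 1) {f : E → E → F} (hf : IsSymbolFamily K N a f)
    (k : ℕ) : IsSymbolFamily K (N + k) a ((_root_.rotDeriv e)^[k] f) := by
  induction k with
  | zero => exact hf
  | succ k ih => rw [Function.iterate_succ_apply']; exact ih.rotDeriv hK

theorem iterate_mulInner {K : Set (E × E)} (hK : ∀ p ∈ K, ‖p.2‖ ≤ 1) {f : E × E → E → F}
    (hf : IsSymbolFamily K N a f) (s : ℕ) :
    IsSymbolFamily K (N + s) (a + s) (_root_.mulInner^[s] f) := by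
  induction s with
  | zero => exact hf
  | succ s ih => rw [Function.iterate_succ_apply']; exact ih.mulInner hK

theorem iterate_dirDeriv {K : Set (E × E)} (hK : ∀ p ∈ K, ‖p.2‖ ≤ 1) {f : E × E → E → F}
    (hf : IsSymbolFamily K N a f) (m : ℕ) :
    IsSymbolFamily K N (a - m) (_root_.dirDeriv^[m] f) := by
  induction m with
  | zero => exact hf
  | succ m ih => rw [Function.iterate_succ_apply']; exact ih.dirDeriv hK

end IsSymbolFamily

theorem iterate_mulInner_apply_smul (f : E × E → E → F) (u : E) {v : E} (hv : ‖v‖ = 1) (r : ℝ)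
    (s : ℕ) : mulInner^[s] f (u, v) (r • v) = r ^ s • f (u, v) (r • v) := by
  induction s with
  | zero => simp
  | succ s ih =>
    rw [Function.iterate_succ_apply', mulInner, ih, inner_smul_right, real_inner_self_eq_norm_sq,
      hv, smul_smul]
    congr 1
    ring

theorem norm_cos_smul_add_sin_smul_s13 {e u : E} (he : ‖e‖ = 1) (hu : ‖u‖ = 1) (heu : ⟪e, u⟫ = 0)
    (θ : ℝ) : ‖cos θ • e + sin θ • u‖ = 1 := by
  have h : ‖cos θ • e + sin θ • u‖ ^ 2 = 1 := by
    rw [norm_add_sq_real, norm_smul, norm_smul, inner_smul_left, inner_smul_right, he, hu, heu]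
    simp
  exact (pow_eq_one_iff_of_nonneg (norm_nonneg _) two_ne_zero).1 h

theorem iteratedDeriv_eq_of_hasDerivAt {g : ℕ → ℝ → F}
    (hg : ∀ j t, HasDerivAt (g j) (g (j + 1) t) t) (k : ℕ) : iteratedDeriv k (g 0) = g k := by
  induction k with
  | zero => exact iteratedDeriv_zero
  | succ k ih =>
    rw [iteratedDeriv_succ, ih]
    exact funext fun t => (hg k t).deriv

/-- Taylor bound for a function vanishing to order `A` at the origin. -/
theorem norm_le_mul_pow_of_hasDerivAt {g : ℕ → ℝ → F}
    (hg : ∀ j t, HasDerivAt (g j) (g (j + 1) t) t) {A : ℕ} (hg0 : ∀ j < A, g j 0 = 0) {C : ℝ}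
    (hC : ∀ t ∈ Icc (0 : ℝ) 1, ‖g A t‖ ≤ C) (i : ℕ) :
    ∀ j, j + i = A → ∀ t ∈ Icc (0 : ℝ) 1, ‖g j t‖ ≤ C * t ^ i := by
  induction i with
  | zero => rintro j rfl t ht; simpa using hC t ht
  | succ i ih =>
    intro j hj t ht
    have hb : ∀ y ∈ Icc 0 t, ‖g (j + 1) y‖ ≤ C * t ^ i := fun y hy => by
      have hC0 : 0 ≤ C := (norm_nonneg _).trans (hC t ht)
      refine (ih (j + 1) (by omega) y ⟨hy.1, hy.2.trans ht.2⟩).trans ?_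
      have := hy.1
      have := hy.2
      gcongr
    have := (convex_Icc 0 t).norm_image_sub_le_of_norm_hasDerivWithin_le
      (fun y _ => (hg j y).hasDerivWithinAt) hb (left_mem_Icc.2 ht.1) (right_mem_Icc.2 ht.1)
    rw [hg0 j (by omega), sub_zero, sub_zero, Real.norm_of_nonneg ht.1] at this
    rwa [pow_succ, ← mul_assoc]

section SphericalMean

variable {X : Type*} [MeasurableSpace X] [TopologicalSpace X] [OpensMeasurableSpace X]
  [SecondCountableTopology X] {ν : Measure X} [IsFiniteMeasure ν]
  {e : E} {u : X → E} {N a : ℕ}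

theorem IsSymbolFamily.iteratedDeriv_integral_rot (he : ‖e‖ = 1) (hu : Continuous u)
    (hu1 : ∀ x, ‖u x‖ = 1) (heu : ∀ x, ⟪e, u x⟫ = 0) {f : E → E → F}
    (hf : IsSymbolFamily (range u) N a f) (r : ℝ) (k : ℕ) :
    iteratedDeriv k (fun θ : ℝ => ∫ x, f (u x) (r • (cos θ • e + sin θ • u x)) ∂ν) =
      fun θ => ∫ x, (rotDeriv e)^[k] f (u x) (r • (cos θ • e + sin θ • u x)) ∂ν := by
  refine iteratedDeriv_eq_of_hasDerivAt
    (g := fun k θ => ∫ x, (rotDeriv e)^[k] f (u x) (r • (cos θ • e + sin θ • u x)) ∂ν)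
    (fun j θ₀ => ?_) k
  have hK : ∀ v ∈ range u, ‖v‖ ≤ 1 := by rintro _ ⟨x, rfl⟩; exact (hu1 x).le
  have h := (hf.iterate_rotDeriv (e := e) hK j).hasDerivAt_integral (ν := ν) hu mem_range_self
    (c := fun θ x => r • (cos θ • e + sin θ • u x))
    (c' := fun θ x => r • (-sin θ • e + cos θ • u x)) (t₀ := θ₀) (R := |r|)
    (fun θ => by fun_prop) (fun θ => by fun_prop)
    (fun θ x => (((hasDerivAt_cos θ).smul_const e).add
      ((hasDerivAt_sin θ).smul_const (u x))).const_smul r)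
    (fun θ _ x => by
      have h1 := norm_cos_smul_add_sin_smul_s13 he (hu1 x) (heu x)
      have h2 := h1 (θ + π / 2)
      rw [cos_add_pi_div_two, sin_add_pi_div_two] at h2
      rw [norm_smul, norm_smul, h1, h2]
      simp)
  convert h using 2
  funext x
  rw [Function.iterate_succ_apply', rotDeriv]
  congr 1
  rw [inner_smul_right, inner_smul_right, inner_add_right, inner_add_right, inner_smul_right,
    inner_smul_right, inner_smul_right, inner_smul_right, real_inner_self_eq_norm_sq,
    real_inner_self_eq_norm_sq, he, hu1, real_inner_comm e, heu]
  module

theorem IsSymbolFamily.hasDerivAt_integral_radial {K : Set (E × E)} (hu : Continuous u)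
    {v : X → E} (hv : Continuous v) (hv1 : ∀ x, ‖v x‖ = 1) (hK : ∀ x, (u x, v x) ∈ K)
    {f : E × E → E → F} (hf : IsSymbolFamily K N a f) (r : ℝ) :
    HasDerivAt (fun r : ℝ => ∫ x, f (u x, v x) (r • v x) ∂ν)
      (∫ x, dirDeriv f (u x, v x) (r • v x) ∂ν) r := by
  refine hf.hasDerivAt_integral (ν := ν) (hu.prodMk hv) hK (c := fun r x => r • v x)
    (c' := fun _ x => v x) (R := |r| + 1) (fun r => by fun_prop) (fun _ => hv)
    (fun t x => by simpa using (hasDerivAt_id t).smul_const (v x)) fun t ht x => ?_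
  rw [Metric.mem_ball, Real.dist_eq] at ht
  rw [norm_smul, hv1, mul_one, Real.norm_eq_abs]
  exact ⟨by linarith [abs_sub_abs_le_abs_sub t r], by linarith [abs_nonneg r]⟩

/-- For fixed `s` and `k`, the functions `r ↦ r ^ s • ∂_θ ^ k D_r(θ)` have `r`-derivatives `g j`
which grow at most like `(1 + |r|) ^ (N + k + s)`, uniformly in `θ`, and which vanish at the
origin for `j < a + s`. -/
theorem IsSymbolFamily.exists_radial_derivs (he : ‖e‖ = 1) (hu : Continuous u)
    (hu1 : ∀ x, ‖u x‖ = 1) (heu : ∀ x, ⟪e, u x⟫ = 0) {f : E → E → F}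
    (hf : IsSymbolFamily (range u) N a f) (k s : ℕ) :
    ∃ g : ℝ → ℕ → ℝ → F,
      (∀ θ r, g θ 0 r = r ^ s • iteratedDeriv k
        (fun θ : ℝ => ∫ x, f (u x) (r • (cos θ • e + sin θ • u x)) ∂ν) θ) ∧
      (∀ θ j r, HasDerivAt (g θ j) (g θ (j + 1) r) r) ∧
      (∀ j, ∃ C, 0 < C ∧ ∀ θ r, ‖g θ j r‖ ≤ C * (1 + |r|) ^ (N + k + s)) ∧
      ∀ θ, ∀ j < a + s, g θ j 0 = 0 := by
  set v : ℝ → X → E := fun θ x => cos θ • e + sin θ • u x with hv_def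
  have hv (θ : ℝ) : Continuous (v θ) := by fun_prop
  have hv1 (θ x) : ‖v θ x‖ = 1 := norm_cos_smul_add_sin_smul_s13 he (hu1 x) (heu x) θ
  have hK : ∀ w ∈ range u, ‖w‖ ≤ 1 := by rintro _ ⟨x, rfl⟩; exact (hu1 x).le
  set L : Set (E × E) := {p | p.1 ∈ range u ∧ ‖p.2‖ ≤ 1}
  have hL : ∀ p ∈ L, ‖p.2‖ ≤ 1 := fun p hp => hp.2
  have huv (θ x) : (u x, v θ x) ∈ L := ⟨mem_range_self x, (hv1 θ x).le⟩
  set h : ℕ → E × E → E → F := fun j =>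
    dirDeriv^[j] (mulInner^[s] fun p => (rotDeriv e)^[k] f p.1) with h_def
  have hh (j : ℕ) : IsSymbolFamily L (N + k + s) (a + s - j) (h j) :=
    (((hf.iterate_rotDeriv hK k).comp_param contDiff_fst fun p hp => hp.1).iterate_mulInner hL
      s).iterate_dirDeriv hL j
  refine ⟨fun θ j r => ∫ x, h j (u x, v θ x) (r • v θ x) ∂ν, fun θ r => ?_, fun θ j r => ?_,
    fun j => ?_, fun θ j hj => ?_⟩
  · rw [hf.iteratedDeriv_integral_rot he hu hu1 heu, ← integral_smul]
    exact integral_congr_ae (.of_forall fun x =>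
      iterate_mulInner_apply_smul _ _ (hv1 θ x) r s)
  · have := (hh j).hasDerivAt_integral_radial (ν := ν) hu (hv θ) (hv1 θ) (huv θ) r
    simpa only [h_def, Function.iterate_succ_apply'] using this
  · obtain ⟨C, hC⟩ := (hh j).norm_le
    refine ⟨(|C| + 1) * (ν.real univ + 1), by positivity, fun θ r => ?_⟩
    calc _ ≤ (|C| + 1) * (1 + |r|) ^ (N + k + s) * ν.real univ := by
          refine norm_integral_le_of_norm_le_const (.of_forall fun x => ?_)
          refine (hC _ (huv θ x) _).trans ?_
          rw [norm_smul, hv1, mul_one, Real.norm_eq_abs]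
          gcongr
          linarith [le_abs_self C]
      _ ≤ (|C| + 1) * (1 + |r|) ^ (N + k + s) * (ν.real univ + 1) := by gcongr; linarith
      _ = _ := by ring
  · simp only [zero_smul]
    simp [(hh j).apply_zero (by omega) (huv θ _)]

end SphericalMean

end SymbolFamily

/-- `w ↦ (0, w)` as a linear isometry `ℝ^(n) → ℝ^(n + 1)`. -/
noncomputable def euclideanTail (n : ℕ) :
    EuclideanSpace ℝ (Fin n) →ₗᵢ[ℝ] EuclideanSpace ℝ (Fin (n + 1)) where
  toFun w := WithLp.toLp 2 (Fin.cons 0 w.ofLp)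
  map_add' w w' := by ext i; refine Fin.cases ?_ (fun j => ?_) i <;> simp
  map_smul' c w := by ext i; refine Fin.cases ?_ (fun j => ?_) i <;> simp
  norm_map' w := by simp [EuclideanSpace.norm_eq, Fin.sum_univ_succ]

theorem inner_single_zero_euclideanTail {n : ℕ} (w : EuclideanSpace ℝ (Fin n)) :
    ⟪EuclideanSpace.single (0 : Fin (n + 1)) (1 : ℝ), euclideanTail n w⟫ = 0 := by
  simp [euclideanTail, EuclideanSpace.inner_single_left]

theorem Dfun_eq (l' : ℕ) (ς : EuclideanSpace ℝ (Fin (l' + 2)) → ℂ) (r θ : ℝ) :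
    Dfun l' ς r θ = ∫ w : Metric.sphere (0 : EuclideanSpace ℝ (Fin (l' + 1))) 1,
      ς (r • (cos θ • EuclideanSpace.single 0 1 + sin θ • euclideanTail (l' + 1) w))
      ∂((volume : Measure (EuclideanSpace ℝ (Fin (l' + 1)))).toSphere) := by
  unfold Dfun
  congr 1 with w
  congr 1
  ext i
  refine Fin.cases ?_ (fun j => ?_) i <;> simp [euclideanTail, mul_assoc]

/-- bounds on `r`-derivatives of `r^s ∂_θ^k D_r(θ)`. Here `l = l' + 2`. -/
theorem stmt13 (l' n a : ℕ) (hn : l' + 2 ≤ n)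
    (ς : EuclideanSpace ℝ (Fin (l' + 2)) → ℂ) (hς : ContDiff ℝ (⊤ : ℕ∞) ς)
    (hbd : ∀ μ : ℕ, ∃ C : ℝ, ∀ lam : EuclideanSpace ℝ (Fin (l' + 2)),
      ‖iteratedFDeriv ℝ μ ς lam‖ ≤ C * (1 + ‖lam‖) ^ (n - (l' + 2))) :
    ∀ m k s : ℕ,
      (∃ C : ℝ, 0 < C ∧
        ∀ r : ℝ, 0 < r → ∀ θ : ℝ, θ ∈ Icc 0 π →
          ‖iteratedDeriv m (fun r' : ℝ => (r' : ℂ) ^ s *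
              iteratedDeriv k (fun θ' : ℝ => Dfun l' ς r' θ') θ) r‖
            ≤ C * (1 + r) ^ (n - (l' + 2) + k + s)) ∧
      ((∀ μ : ℕ, μ < a → iteratedFDeriv ℝ μ ς 0 = 0) →
        ∃ C' : ℝ, 0 < C' ∧
          ∀ r : ℝ, 0 < r → r ≤ 1 → ∀ θ : ℝ, θ ∈ Icc 0 π →
            ‖iteratedDeriv m (fun r' : ℝ => (r' : ℂ) ^ s *
                iteratedDeriv k (fun θ' : ℝ => Dfun l' ς r' θ') θ) r‖
              ≤ C' * r ^ ((s : ℝ) + a - m)) := by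
  intro m k s
  have main (b : ℕ) (hb : ∀ μ < b, iteratedFDeriv ℝ μ ς 0 = 0) :=
    IsSymbolFamily.exists_radial_derivs (N := n - (l' + 2)) (a := b)
      (e := EuclideanSpace.single (0 : Fin (l' + 2)) (1 : ℝ))
      (u := fun w : Metric.sphere (0 : EuclideanSpace ℝ (Fin (l' + 1))) 1 =>
        euclideanTail (l' + 1) w)
      (ν := (volume : Measure (EuclideanSpace ℝ (Fin (l' + 1)))).toSphere) (f := fun _ => ς)
      (by simp)
      ((euclideanTail (l' + 1)).continuous.comp continuous_subtype_val)
      (fun w => by simp) (fun w => inner_single_zero_euclideanTail _)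
      ⟨hς.comp contDiff_snd, fun μ => (hbd μ).imp fun _ hC _ _ => hC, fun μ hμ _ _ => hb μ hμ⟩
      k s
  have hderiv {g : ℝ → ℕ → ℝ → ℂ} (hg0 : ∀ θ r, g θ 0 r = r ^ s • iteratedDeriv k
        (fun θ : ℝ => ∫ w : Metric.sphere (0 : EuclideanSpace ℝ (Fin (l' + 1))) 1,
          ς (r • (cos θ • EuclideanSpace.single 0 1 + sin θ • euclideanTail (l' + 1) w))
          ∂((volume : Measure (EuclideanSpace ℝ (Fin (l' + 1)))).toSphere)) θ)
      (hg : ∀ θ j r, HasDerivAt (g θ j) (g θ (j + 1) r) r) (θ : ℝ) :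
      iteratedDeriv m (fun r' : ℝ => (r' : ℂ) ^ s *
        iteratedDeriv k (fun θ' : ℝ => Dfun l' ς r' θ') θ) = g θ m := by
    rw [← iteratedDeriv_eq_of_hasDerivAt (hg θ) m]
    congr 1
    funext r
    rw [hg0]
    simp only [Dfun_eq, Complex.real_smul, Complex.ofReal_pow]
  constructor
  · obtain ⟨g, hg0, hg, hbound, -⟩ := main 0 (by simp)
    obtain ⟨C, hC, hgC⟩ := hbound m
    refine ⟨C, hC, fun r hr θ _ => ?_⟩
    rw [hderiv hg0 hg]
    simpa only [abs_of_pos hr] using hgC θ r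
  · intro hvan
    obtain ⟨g, hg0, hg, hbound, hg_zero⟩ := main a hvan
    have hbound' (j : ℕ) : ∃ C, 0 < C ∧ ∀ θ, ∀ r ∈ Icc (0 : ℝ) 1, ‖g θ j r‖ ≤ C := by
      obtain ⟨C, hC, hgC⟩ := hbound j
      refine ⟨C * 2 ^ (n - (l' + 2) + k + s), by positivity, fun θ r hr => (hgC θ r).trans ?_⟩
      rw [abs_of_nonneg hr.1]
      have := hr.1
      gcongr
      linarith [hr.2]
    rcases le_total m (a + s) with hm | hm
    · obtain ⟨C, hC, hgC⟩ := hbound' (a + s)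
      refine ⟨C, hC, fun r hr hr1 θ _ => ?_⟩
      have hexp : (s : ℝ) + a - m = ((a + s - m : ℕ) : ℝ) := by
        push_cast [hm]
        ring
      rw [hderiv hg0 hg, hexp, rpow_natCast]
      exact norm_le_mul_pow_of_hasDerivAt (hg θ) (hg_zero θ) (hgC θ) (a + s - m) m (by omega) r
        ⟨hr.le, hr1⟩
    · obtain ⟨C, hC, hgC⟩ := hbound' m
      refine ⟨C, hC, fun r hr hr1 θ _ => ?_⟩
      rw [hderiv hg0 hg]
      refine (hgC θ r ⟨hr.le, hr1⟩).trans (le_mul_of_one_le_right hC.le ?_)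
      have hm' : (a : ℝ) + s ≤ m := mod_cast hm
      exact one_le_rpow_of_pos_of_le_one_of_nonpos hr hr1 (by linarith)
end
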